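/- arXiv:1807.05573 — 3 statements merged into one kernel-verified Lean document; each statement's English description precedes it below -/
import Mathlib

section
/- Let X be a UMD Banach space, 1 ≤ p < ∞, and M : ℝ₊ × Ω → X a martingale such that E sup_{t≥0} ‖M_t‖^p < ∞. Then there exists a sequence (M^n)_{n≥1} of X-valued L^∞-bounded martingales such that E sup_{t≥0} ‖M_t − M^n_t‖^p → 0 as n → ∞. -/
open MeasureTheory ProbabilityTheory Filter
open scoped ENNReal NNReal Topology InnerProductSpace Classical

noncomputable section

/-- `(d_n)` is an `X`-valued martingale difference sequence w.r.t. the filtration `ℱ`,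
i.e. the partial sums `f_m = Σ_{n<m} d_n` form a martingale. -/
def IsMartDiffSeq {Ω X : Type*} [NormedAddCommGroup X] [NormedSpace ℝ X] [CompleteSpace X]
    {m : MeasurableSpace Ω} (ℱ : Filtration ℕ m) (P : Measure Ω) (d : ℕ → Ω → X) : Prop :=
  Martingale (fun n ω => ∑ j ∈ Finset.range n, d j ω) ℱ P

/-- `X` is a UMD Banach space: for all `p ∈ (1,∞)` there is `β > 0` such that for every
martingale difference sequence `(d_j)` and every choice of signs `(ε_j)`,
`(E‖Σ_{j<n} ε_j d_j‖^p)^{1/p} ≤ β (E‖Σ_{j<n} d_j‖^p)^{1/p}`. -/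
def IsUMD (X : Type*) [NormedAddCommGroup X] [NormedSpace ℝ X] [CompleteSpace X] : Prop :=
  ∀ p : ℝ, 1 < p → ∃ β : ℝ, 0 < β ∧
    ∀ (Ω : Type) (m : MeasurableSpace Ω) (P : Measure Ω), IsProbabilityMeasure P →
      ∀ (ℱ : Filtration ℕ m) (d : ℕ → Ω → X), IsMartDiffSeq ℱ P d →
        ∀ ε : ℕ → ℝ, (∀ j, ε j = 1 ∨ ε j = -1) →
          ∀ n : ℕ,
            (∫⁻ ω, (‖∑ j ∈ Finset.range n, ε j • d j ω‖₊ : ℝ≥0∞) ^ p ∂P) ^ (1 / p) ≤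
              ENNReal.ofReal β * (∫⁻ ω, (‖∑ j ∈ Finset.range n, d j ω‖₊ : ℝ≥0∞) ^ p ∂P) ^ (1 / p)

section HilbertCompactness

/-- An antitone directed family of nonempty bounded closed convex subsets of a Hilbert space has
a common point. -/
theorem exists_forall_mem_of_antitone_convex {H I : Type*} [NormedAddCommGroup H]
    [InnerProductSpace ℝ H] [CompleteSpace H] [SemilatticeSup I] [Nonempty I] {K : I → Set H}
    (hanti : Antitone K) (hne : ∀ i, (K i).Nonempty) (hcl : ∀ i, IsClosed (K i))
    (hconv : ∀ i, Convex ℝ (K i)) {R : ℝ} (hR : ∀ i, ∀ v ∈ K i, ‖v‖ ≤ R) :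
    ∃ v, ∀ i, v ∈ K i := by
  have hmin : ∀ i, ∃ v ∈ K i, ∀ w ∈ K i, ‖v‖ ≤ ‖w‖ := by
    intro i
    obtain ⟨v, hv, hv'⟩ :=
      exists_norm_eq_iInf_of_complete_convex (hne i) (hcl i).isComplete (hconv i) 0
    refine ⟨v, hv, fun w hw => ?_⟩
    have h1 : (⨅ w : K i, ‖(0 : H) - w‖) ≤ ‖(0 : H) - (⟨w, hw⟩ : K i)‖ :=
      ciInf_le ⟨0, by rintro _ ⟨x, rfl⟩; exact norm_nonneg _⟩ _
    rw [← hv'] at h1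
    simpa using h1
  choose v hvK hvmin using hmin
  have hdist : ∀ i j, i ≤ j → ‖v i - v j‖ ^ 2 ≤ 2 * (‖v j‖ ^ 2 - ‖v i‖ ^ 2) := by
    intro i j hij
    have hmid : (2⁻¹ : ℝ) • v i + (2⁻¹ : ℝ) • v j ∈ K i :=
      hconv i (hvK i) (hanti hij (hvK j)) (by norm_num) (by norm_num) (by norm_num)
    have h1 := hvmin i _ hmid
    rw [← smul_add, norm_smul] at h1
    have h2 : 2 * ‖v i‖ ≤ ‖v i + v j‖ := by
      norm_num at h1
      linarith
    have h3 := parallelogram_law_with_norm ℝ (v i) (v j)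
    nlinarith [norm_nonneg (v i)]
  have hbdd : BddAbove (Set.range fun i => ‖v i‖ ^ 2) := by
    refine ⟨R ^ 2, ?_⟩
    rintro _ ⟨i, rfl⟩
    exact pow_le_pow_left₀ (norm_nonneg _) (hR i _ (hvK i)) 2
  have hcau : CauchySeq v := by
    rw [Metric.cauchySeq_iff']
    intro ε hε
    obtain ⟨i, hi⟩ := exists_lt_of_lt_ciSup
      (show (⨆ i, ‖v i‖ ^ 2) - ε ^ 2 / 2 < ⨆ i, ‖v i‖ ^ 2 by nlinarith [sq_pos_of_pos hε])
    refine ⟨i, fun j hj => ?_⟩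
    have h1 := hdist i j hj
    have h2 : ‖v j‖ ^ 2 ≤ ⨆ i, ‖v i‖ ^ 2 := le_ciSup hbdd j
    rw [dist_comm, dist_eq_norm]
    exact lt_of_pow_lt_pow_left₀ 2 hε.le (by linarith)
  obtain ⟨x, hx⟩ := cauchySeq_tendsto_of_complete hcau
  refine ⟨x, fun i => (hcl i).mem_of_tendsto hx ?_⟩
  filter_upwards [eventually_ge_atTop i] with j hj using hanti hj (hvK j)

/-- If bounded elements `u D` of a Hilbert space determine the values `Φ n D` up to arbitrarily
small errors through continuous linear maps, then the `Φ n D` have limits along common convex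
combinations taken over arbitrarily large indices `D`. -/
theorem exists_limit_convex_combinations {H Y I : Type*} [NormedAddCommGroup H]
    [InnerProductSpace ℝ H] [CompleteSpace H] [NormedAddCommGroup Y] [NormedSpace ℝ Y]
    [CompleteSpace Y] [SemilatticeSup I] [Nonempty I] {u : I → H} {R : ℝ} (hu : ∀ D, ‖u D‖ ≤ R)
    {Φ : ℕ → I → Y}
    (hΦ : ∀ n, ∀ δ > 0, ∃ A : H →L[ℝ] Y, ∀ D, ‖Φ n D - A (u D)‖ ≤ δ) :
    ∃ y : ℕ → Y, ∀ (D : I) (N : ℕ), ∀ δ > 0, ∃ (κ : Type) (_ : Fintype κ) (w : κ → ℝ) (d : κ → I),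
      (∀ i, D ≤ d i) ∧ (∀ i, 0 ≤ w i) ∧ ∑ i, w i = 1 ∧
      ∀ n ≤ N, ‖∑ i, w i • Φ n (d i) - y n‖ ≤ δ := by
  obtain ⟨v, hv⟩ := exists_forall_mem_of_antitone_convex
    (K := fun D => closure (convexHull ℝ (u '' Set.Ici D)))
    (fun D D' h => closure_mono (convexHull_mono (Set.image_mono (Set.Ici_subset_Ici.2 h))))
    (fun D => ⟨u D, subset_closure (subset_convexHull _ _ ⟨D, Set.self_mem_Ici, rfl⟩)⟩)
    (fun D => isClosed_closure) (fun D => (convex_convexHull _ _).closure) (R := R) (by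
      intro D x hx
      have : closure (convexHull ℝ (u '' Set.Ici D)) ⊆ Metric.closedBall 0 R := by
        refine closure_minimal (convexHull_min ?_ (convex_closedBall _ _))
          Metric.isClosed_closedBall
        rintro _ ⟨i, -, rfl⟩
        simpa using hu i
      simpa using this hx)
  choose A hA using fun n (k : ℕ) => hΦ n (1 / ((k : ℝ) + 1)) Nat.one_div_pos_of_nat
  let D₀ : I := Classical.arbitrary I
  have hcomp : ∀ n k l, ‖A n k v - A n l v‖ ≤ 1 / ((k : ℝ) + 1) + 1 / ((l : ℝ) + 1) := by
    intro n k l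
    have hsub : closure (convexHull ℝ (u '' Set.Ici D₀)) ⊆
        (A n k - A n l) ⁻¹' Metric.closedBall 0 (1 / ((k : ℝ) + 1) + 1 / ((l : ℝ) + 1)) := by
      refine closure_minimal (convexHull_min ?_ ?_)
        (Metric.isClosed_closedBall.preimage (A n k - A n l).continuous)
      · rintro _ ⟨i, -, rfl⟩
        have h1 := hA n k i
        have h2 := hA n l i
        simp only [Set.mem_preimage, sub_apply, mem_closedBall_zero_iff]
        calc ‖A n k (u i) - A n l (u i)‖
            = ‖(Φ n i - A n l (u i)) - (Φ n i - A n k (u i))‖ := by congr 1; abel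
          _ ≤ _ := (norm_sub_le _ _).trans (by linarith)
      · exact (convex_closedBall _ _).linear_preimage (A n k - A n l).toLinearMap
    simpa using hsub (hv D₀)
  have hlim0 : Tendsto (fun k : ℕ => 1 / ((k : ℝ) + 1)) atTop (𝓝 0) :=
    tendsto_one_div_add_atTop_nhds_zero_nat
  have hcau : ∀ n, CauchySeq fun k => A n k v := by
    intro n
    refine cauchySeq_of_le_tendsto_0 (fun N : ℕ => 2 * (1 / ((N : ℝ) + 1))) ?_ ?_
    · intro k l N hk hl
      rw [dist_eq_norm]
      have h1 := Nat.one_div_le_one_div (α := ℝ) hk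
      have h2 := Nat.one_div_le_one_div (α := ℝ) hl
      linarith [hcomp n k l]
    · simpa using hlim0.const_mul 2
  choose y hy using fun n => cauchySeq_tendsto_of_complete (hcau n)
  refine ⟨y, fun D N δ hδ => ?_⟩
  have hyk : ∀ n k, ‖A n k v - y n‖ ≤ 1 / ((k : ℝ) + 1) := by
    intro n k
    have h1 : Tendsto (fun l => ‖A n k v - A n l v‖) atTop (𝓝 ‖A n k v - y n‖) :=
      (tendsto_const_nhds.sub (hy n)).norm
    have h2 : Tendsto (fun l : ℕ => 1 / ((k : ℝ) + 1) + 1 / ((l : ℝ) + 1)) atTop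
        (𝓝 (1 / ((k : ℝ) + 1) + 0)) := tendsto_const_nhds.add hlim0
    simpa using le_of_tendsto_of_tendsto' h1 h2 fun l => hcomp n k l
  obtain ⟨k, hk⟩ := exists_nat_one_div_lt (show (0 : ℝ) < δ / 3 by positivity)
  have hnear : ∃ z ∈ convexHull ℝ (u '' Set.Ici D), ∀ n ≤ N, ‖A n k z - A n k v‖ < δ / 3 := by
    have hopen : IsOpen (⋂ n ∈ Set.Iic N, {z | ‖A n k z - A n k v‖ < δ / 3}) :=
      (Set.finite_Iic N).isOpen_biInter fun n _ =>
        isOpen_lt (((A n k).continuous.sub continuous_const).norm) continuous_const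
    obtain ⟨z, hz, hz'⟩ := mem_closure_iff.1 (hv D) _ hopen (by
      simp only [Set.mem_iInter, Set.mem_ofPred_eq, sub_self, norm_zero]
      intro _ _; positivity)
    refine ⟨z, hz', fun n hn => ?_⟩
    simp only [Set.mem_iInter, Set.mem_ofPred_eq] at hz
    exact hz n hn
  obtain ⟨z, hz, hz'⟩ := hnear
  obtain ⟨κ, hκ, w, q, hw0, hw1, hq, rfl⟩ := mem_convexHull_iff_exists_fintype.1 hz
  choose d hd hdq using hq
  obtain rfl : q = fun i => u (d i) := funext fun i => (hdq i).symm
  refine ⟨κ, hκ, w, d, hd, hw0, hw1, fun n hn => ?_⟩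
  have h1 : ‖∑ i, w i • Φ n (d i) - A n k (∑ i, w i • u (d i))‖ ≤ δ / 3 := by
    rw [map_sum]
    simp only [map_smul]
    rw [← Finset.sum_sub_distrib]
    calc ‖∑ i, (w i • Φ n (d i) - w i • A n k (u (d i)))‖
        ≤ ∑ i, w i * (δ / 3) := by
          refine norm_sum_le_of_le _ fun i _ => ?_
          rw [← smul_sub, norm_smul, Real.norm_of_nonneg (hw0 i)]
          exact mul_le_mul_of_nonneg_left ((hA n k (d i)).trans hk.le) (hw0 i)
      _ = δ / 3 := by rw [← Finset.sum_mul, hw1, one_mul]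
  have h2 := hz' n hn
  have h3 := hyk n k
  calc ‖∑ i, w i • Φ n (d i) - y n‖
      = ‖(∑ i, w i • Φ n (d i) - A n k (∑ i, w i • u (d i))) +
          (A n k (∑ i, w i • u (d i)) - A n k v) + (A n k v - y n)‖ := by congr 1; abel
    _ ≤ _ := (norm_add₃_le).trans (by linarith)

end HilbertCompactness

section CountableSupremum

variable {Ω : Type*} {m : MeasurableSpace Ω}

/-- The suprema over initial segments of a family of measurable functions indexed by `ℝ≥0` are
almost surely determined by one countable set of indices. -/
theorem exists_countable_ae_le_iSup (P : Measure Ω) [IsProbabilityMeasure P]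
    {Z : ℝ≥0 → Ω → ℝ≥0∞} (hZ : ∀ t, Measurable (Z t)) :
    ∃ C : Set ℝ≥0, C.Countable ∧ ∀ t, ∀ᵐ ω ∂P, Z t ω ≤ ⨆ s ∈ C ∩ Set.Iic t, Z s ω := by
  let f : Set ℝ≥0 → Ω → ℝ≥0∞ := fun S ω => (1 + ⨆ s ∈ S, Z s ω)⁻¹
  let Ψ : Set ℝ≥0 → ℝ≥0∞ := fun S => ∫⁻ ω, f S ω ∂P
  have hf : ∀ {S S' : Set ℝ≥0}, S ⊆ S' → ∀ ω, f S' ω ≤ f S ω := fun h ω =>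
    ENNReal.inv_le_inv.2 (add_le_add_right (biSup_mono fun _ hs => h hs) 1)
  have hΨ : ∀ {S S' : Set ℝ≥0}, S ⊆ S' → Ψ S' ≤ Ψ S := fun h => lintegral_mono (hf h)
  have hf1 : ∀ S ω, f S ω ≤ 1 := fun S ω => ENNReal.inv_le_one.2 le_self_add
  have hΨ1 : ∀ S, Ψ S ≠ ⊤ := fun S =>
    ((lintegral_mono (hf1 S)).trans_lt (by simp)).ne
  have hfm : ∀ {S : Set ℝ≥0}, S.Countable → Measurable (f S) := fun hS =>
    (measurable_const.add (Measurable.biSup _ hS fun s _ => hZ s)).inv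
  let v : ℝ≥0 → ℝ≥0∞ := fun t => ⨅ S ∈ {S : Set ℝ≥0 | S.Countable ∧ S ⊆ Set.Iic t}, Ψ S
  have hv_le : ∀ {t S}, S.Countable → S ⊆ Set.Iic t → v t ≤ Ψ S := fun h1 h2 =>
    iInf₂_le _ ⟨h1, h2⟩
  have hv_anti : Antitone v := fun s t hst => le_iInf₂ fun S hS =>
    hv_le hS.1 (hS.2.trans (Set.Iic_subset_Iic.2 hst))
  have hatt : ∀ t, ∃ S : Set ℝ≥0, S.Countable ∧ S ⊆ Set.Iic t ∧ Ψ S ≤ v t := by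
    intro t
    have hvt : v t ≠ ⊤ :=
      ((hv_le Set.countable_empty (Set.empty_subset _)).trans_lt (hΨ1 ∅).lt_top).ne
    have : ∀ n : ℕ, ∃ S : Set ℝ≥0, (S.Countable ∧ S ⊆ Set.Iic t) ∧ Ψ S < v t + (n : ℝ≥0∞)⁻¹ := by
      intro n
      have : v t < v t + (n : ℝ≥0∞)⁻¹ :=
        ENNReal.lt_add_right hvt (ENNReal.inv_ne_zero.2 (ENNReal.natCast_ne_top n))
      obtain ⟨S, hlt'⟩ := iInf_lt_iff.1 this
      obtain ⟨hS, hlt⟩ := iInf_lt_iff.1 hlt'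
      exact ⟨S, hS, hlt⟩
    choose S hS hlt using this
    refine ⟨⋃ n, S n, Set.countable_iUnion fun n => (hS n).1, Set.iUnion_subset fun n => (hS n).2,
      ?_⟩
    have h1 : Tendsto (fun n : ℕ => v t + (n : ℝ≥0∞)⁻¹) atTop (𝓝 (v t + 0)) :=
      tendsto_const_nhds.add ENNReal.tendsto_inv_nat_nhds_zero
    rw [add_zero] at h1
    exact ge_of_tendsto' h1 fun n => (hΨ (Set.subset_iUnion S n)).trans (hlt n).le
  choose S hSc hSt hSv using hatt
  obtain ⟨Q, hQc, hQd⟩ := TopologicalSpace.exists_countable_dense ℝ≥0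
  let J : Set ℝ≥0 := Q ∪ {0} ∪ {t | ¬ContinuousAt v t}
  have hJ : J.Countable := (hQc.union (Set.countable_singleton 0)).union
    hv_anti.countable_not_continuousAt
  refine ⟨⋃ q ∈ J, S q, hJ.biUnion fun q _ => hSc q, fun t => ?_⟩
  set C : Set ℝ≥0 := ⋃ q ∈ J, S q with hC
  have hCc : C.Countable := hJ.biUnion fun q _ => hSc q
  have hsub : ∀ q ∈ J, q ≤ t → S q ⊆ C ∩ Set.Iic t := fun q hq hqt =>
    Set.subset_inter (Set.subset_biUnion_of_mem (u := S) hq)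
      ((hSt q).trans (Set.Iic_subset_Iic.2 hqt))
  have hkey : Ψ (C ∩ Set.Iic t) ≤ v t := by
    by_cases ht : t ∈ J
    · exact (hΨ (hsub t ht le_rfl)).trans (hSv t)
    · have ht0 : 0 < t := by
        rw [pos_iff_ne_zero]
        rintro rfl
        exact ht (Or.inl (Or.inr rfl))
      have hcont : ContinuousAt v t := by
        by_contra h
        exact ht (Or.inr h)
      have hne : (𝓝[<] t).NeBot := nhdsLT_neBot_of_exists_lt ⟨0, ht0⟩
      refine ge_of_tendsto (hcont.tendsto.mono_left (nhdsWithin_le_nhds (s := Set.Iio t))) ?_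
      filter_upwards [self_mem_nhdsWithin] with s hs
      obtain ⟨q, hqQ, hq⟩ := hQd.exists_between (Set.mem_Iio.1 hs)
      exact (hΨ (hsub q (Or.inl (Or.inl hqQ)) hq.2.le)).trans ((hSv q).trans (hv_anti hq.1.le))
  have hins : insert t (C ∩ Set.Iic t) ⊆ Set.Iic t :=
    Set.insert_subset Set.self_mem_Iic Set.inter_subset_right
  have hCt : (C ∩ Set.Iic t).Countable := hCc.mono Set.inter_subset_left
  have heq := ae_eq_of_ae_le_of_lintegral_le (μ := P)
    (ae_of_all _ (hf (Set.subset_insert t (C ∩ Set.Iic t)))) (hΨ1 _) (hfm hCt).aemeasurable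
    (hkey.trans (hv_le (hCt.insert t) hins))
  filter_upwards [heq] with ω hω
  have h1 : (1 + ⨆ s ∈ insert t (C ∩ Set.Iic t), Z s ω) = 1 + ⨆ s ∈ C ∩ Set.Iic t, Z s ω :=
    inv_injective hω
  rw [ENNReal.add_right_inj ENNReal.one_ne_top] at h1
  rw [← h1]
  exact le_biSup (fun s => Z s ω) (Set.mem_insert _ _)

end CountableSupremum

section CutoffTransform

variable {Ω E F : Type*} {m : MeasurableSpace Ω} {P : Measure Ω}
  [NormedAddCommGroup E] [NormedSpace ℝ E] [NormedAddCommGroup F] [NormedSpace ℝ F]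

/-- A pair of decreasing `[0, 1]`-valued cutoff processes along a discrete filtration; `a` is
adapted and `b` is predictable. -/
structure Cutoff (𝒢 : Filtration ℕ m) (a b : ℕ → Ω → ℝ) : Prop where
  a_meas : ∀ i, StronglyMeasurable[𝒢 i] (a i)
  b_zero_meas : StronglyMeasurable[𝒢 0] (b 0)
  b_succ_meas : ∀ i, StronglyMeasurable[𝒢 i] (b (i + 1))
  a_nonneg : ∀ i ω, 0 ≤ a i ω
  a_zero_le : ∀ ω, a 0 ω ≤ 1
  a_succ_le : ∀ i ω, a (i + 1) ω ≤ a i ω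
  b_nonneg : ∀ i ω, 0 ≤ b i ω
  b_zero_le : ∀ ω, b 0 ω ≤ 1
  b_succ_le : ∀ i ω, b (i + 1) ω ≤ b i ω

/-- The predictable part of the cutoff transform. -/
def cutoffDrift (P : Measure Ω) (𝒢 : Filtration ℕ m) (a b : ℕ → Ω → ℝ) (f : Ω → E)
    (i : ℕ) (ω : Ω) : E :=
  ∑ j ∈ Finset.range i, (((b j ω - b (j + 1) ω) * a j ω) • (P[f|𝒢 j]) ω +
    b (j + 1) ω • (P[fun ω => (a j ω - a (j + 1) ω) • f ω|𝒢 j]) ω)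

/-- The martingale obtained from `P[f|𝒢 i]` by killing it with `a`, compensating, and stopping the
result with `b`. -/
def cutoffTransform (P : Measure Ω) (𝒢 : Filtration ℕ m) (a b : ℕ → Ω → ℝ) (f : Ω → E)
    (i : ℕ) (ω : Ω) : E :=
  cutoffDrift P 𝒢 a b f i ω + (b i ω * a i ω) • (P[f|𝒢 i]) ω

variable {𝒢 : Filtration ℕ m} {a b : ℕ → Ω → ℝ} {f g : Ω → E}

lemma cutoffDrift_succ (f : Ω → E) (i : ℕ) (ω : Ω) :
    cutoffDrift P 𝒢 a b f (i + 1) ω = cutoffDrift P 𝒢 a b f i ω +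
      (((b i ω - b (i + 1) ω) * a i ω) • (P[f|𝒢 i]) ω +
        b (i + 1) ω • (P[fun ω => (a i ω - a (i + 1) ω) • f ω|𝒢 i]) ω) :=
  Finset.sum_range_succ _ _

namespace Cutoff

lemma a_le_one (h : Cutoff 𝒢 a b) (i : ℕ) (ω : Ω) : a i ω ≤ 1 := by
  induction i with
  | zero => exact h.a_zero_le ω
  | succ i ih => exact (h.a_succ_le i ω).trans ih

lemma b_le_one (h : Cutoff 𝒢 a b) (i : ℕ) (ω : Ω) : b i ω ≤ 1 := by
  induction i with
  | zero => exact h.b_zero_le ω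
  | succ i ih => exact (h.b_succ_le i ω).trans ih

lemma b_meas (h : Cutoff 𝒢 a b) (i : ℕ) : StronglyMeasurable[𝒢 i] (b i) := by
  cases i with
  | zero => exact h.b_zero_meas
  | succ i => exact (h.b_succ_meas i).mono (𝒢.mono i.le_succ)

lemma sub_meas (h : Cutoff 𝒢 a b) (j : ℕ) :
    StronglyMeasurable[𝒢 (j + 1)] fun ω => a j ω - a (j + 1) ω :=
  ((h.a_meas j).mono (𝒢.mono j.le_succ)).sub (h.a_meas (j + 1))

lemma norm_sub_le (h : Cutoff 𝒢 a b) (j : ℕ) (ω : Ω) : ‖a j ω - a (j + 1) ω‖ ≤ 1 := by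
  rw [Real.norm_eq_abs, abs_le]
  constructor <;> linarith [h.a_nonneg j ω, h.a_nonneg (j + 1) ω, h.a_le_one j ω,
    h.a_le_one (j + 1) ω]

lemma integrable_sub_smul (h : Cutoff 𝒢 a b) (hf : Integrable f P) (j : ℕ) :
    Integrable (fun ω => (a j ω - a (j + 1) ω) • f ω) P :=
  hf.bdd_smul 1 ((h.sub_meas j).mono (𝒢.le _)).aestronglyMeasurable
    (.of_forall (h.norm_sub_le j))

lemma integrable_smul (h : Cutoff 𝒢 a b) (hf : Integrable f P) (j : ℕ) :
    Integrable (fun ω => a j ω • f ω) P :=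
  hf.bdd_smul 1 ((h.a_meas j).mono (𝒢.le _)).aestronglyMeasurable
    (.of_forall fun ω => by
      rw [Real.norm_of_nonneg (h.a_nonneg j ω)]; exact h.a_le_one j ω)

end Cutoff

lemma Cutoff.stronglyMeasurable_drift_succ [CompleteSpace E] (h : Cutoff 𝒢 a b) (i : ℕ) :
    StronglyMeasurable[𝒢 i] (cutoffDrift P 𝒢 a b f (i + 1)) := by
  refine Finset.stronglyMeasurable_fun_sum _ fun j hj => ?_
  have hji : j ≤ i := Nat.lt_succ_iff.1 (Finset.mem_range.1 hj)
  refine StronglyMeasurable.mono ?_ (𝒢.mono hji)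
  exact ((((h.b_meas j).sub (h.b_succ_meas j)).mul (h.a_meas j)).smul
    stronglyMeasurable_condExp).add ((h.b_succ_meas j).smul stronglyMeasurable_condExp)

lemma Cutoff.stronglyMeasurable_transform [CompleteSpace E] (h : Cutoff 𝒢 a b) (i : ℕ) :
    StronglyMeasurable[𝒢 i] (cutoffTransform P 𝒢 a b f i) := by
  refine StronglyMeasurable.add ?_ (((h.b_meas i).mul (h.a_meas i)).smul stronglyMeasurable_condExp)
  cases i with
  | zero =>
    have : cutoffDrift P 𝒢 a b f 0 = fun _ => 0 := by ext ω; simp [cutoffDrift]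
    rw [this]; exact stronglyMeasurable_const
  | succ i => exact (h.stronglyMeasurable_drift_succ i).mono (𝒢.mono i.le_succ)

lemma Cutoff.integrable_drift [CompleteSpace E] (h : Cutoff 𝒢 a b) (i : ℕ) :
    Integrable (cutoffDrift P 𝒢 a b f i) P := by
  refine integrable_finsetSum _ fun j _ => ?_
  refine Integrable.add ?_ ?_
  · refine integrable_condExp.bdd_smul 1 ((((h.b_meas j).sub (h.b_succ_meas j)).mul
      (h.a_meas j)).mono (𝒢.le _)).aestronglyMeasurable (.of_forall fun ω => ?_)
    have h1 := h.b_nonneg (j + 1) ω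
    have h2 := h.b_succ_le j ω
    have h3 := h.b_le_one j ω
    have h4 := h.a_nonneg j ω
    have h5 := h.a_le_one j ω
    rw [Real.norm_of_nonneg (mul_nonneg (by linarith) h4)]
    exact mul_le_one₀ (by linarith) h4 h5
  · refine integrable_condExp.bdd_smul 1
      ((h.b_succ_meas j).mono (𝒢.le _)).aestronglyMeasurable (.of_forall fun ω => ?_)
    rw [Real.norm_of_nonneg (h.b_nonneg _ ω)]
    exact h.b_le_one _ ω

lemma Cutoff.integrable_transform [CompleteSpace E] (h : Cutoff 𝒢 a b) (i : ℕ) :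
    Integrable (cutoffTransform P 𝒢 a b f i) P := by
  refine (h.integrable_drift i).add ?_
  refine integrable_condExp.bdd_smul 1 (((h.b_meas i).mul
    (h.a_meas i)).mono (𝒢.le _)).aestronglyMeasurable (.of_forall fun ω => ?_)
  rw [Real.norm_of_nonneg (mul_nonneg (h.b_nonneg i ω) (h.a_nonneg i ω))]
  exact mul_le_one₀ (h.b_le_one i ω) (h.a_nonneg i ω) (h.a_le_one i ω)

/-- Pulling out a bounded measurable factor, in the form of the tower property. -/
lemma condExp_smul_condExp [CompleteSpace E] [IsFiniteMeasure P] {m₁ m₂ : MeasurableSpace Ω}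
    (h₁₂ : m₁ ≤ m₂) (h₂ : m₂ ≤ m) {c : Ω → ℝ} (hc : StronglyMeasurable[m₂] c)
    (hf : Integrable f P) (hcf : Integrable (fun ω => c ω • f ω) P) :
    P[fun ω => c ω • (P[f|m₂]) ω|m₁] =ᵐ[P] P[fun ω => c ω • f ω|m₁] :=
  (condExp_congr_ae (condExp_smul_of_aestronglyMeasurable_left hc.aestronglyMeasurable
    hcf hf).symm).trans (condExp_condExp_of_le h₁₂ h₂)

lemma Cutoff.condExp_transform_succ [CompleteSpace E] [IsFiniteMeasure P] (h : Cutoff 𝒢 a b)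
    (hf : Integrable f P) (i : ℕ) :
    P[cutoffTransform P 𝒢 a b f (i + 1)|𝒢 i] =ᵐ[P] cutoffTransform P 𝒢 a b f i := by
  have hG : Integrable (fun ω => a (i + 1) ω • (P[f|𝒢 (i + 1)]) ω) P :=
    h.integrable_smul integrable_condExp _
  have hbG : Integrable ((b (i + 1)) • fun ω => a (i + 1) ω • (P[f|𝒢 (i + 1)]) ω) P :=
    hG.bdd_smul 1 ((h.b_meas _).mono (𝒢.le _)).aestronglyMeasurable
    (.of_forall fun ω => by
      rw [Real.norm_of_nonneg (h.b_nonneg _ ω)]; exact h.b_le_one _ ω)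
  have e : cutoffTransform P 𝒢 a b f (i + 1) = cutoffDrift P 𝒢 a b f (i + 1) +
      (b (i + 1)) • fun ω => a (i + 1) ω • (P[f|𝒢 (i + 1)]) ω := by
    ext ω; simp [cutoffTransform, mul_smul]
  have e1 := condExp_add (h.integrable_drift (f := f) (i + 1)) hbG (𝒢 i)
  have e2 := condExp_smul_of_aestronglyMeasurable_left
    (h.b_succ_meas i).aestronglyMeasurable hbG hG
  have e3 := condExp_smul_condExp (𝒢.mono i.le_succ) (𝒢.le (i + 1)) (h.a_meas (i + 1)) hf
    (h.integrable_smul hf _)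
  have e4 := condExp_sub (h.integrable_smul hf i) (h.integrable_smul hf (i + 1)) (𝒢 i)
  have e5 := condExp_smul_of_aestronglyMeasurable_left
    (h.a_meas i).aestronglyMeasurable (h.integrable_smul hf i) hf
  have e6 := condExp_of_stronglyMeasurable (𝒢.le i)
    (h.stronglyMeasurable_drift_succ (P := P) (f := f) i) (h.integrable_drift (i + 1))
  have e7 : ((fun ω => a i ω • f ω) - fun ω => a (i + 1) ω • f ω) =
    fun ω => (a i ω - a (i + 1) ω) • f ω := by ext ω; simp [sub_smul]
  rw [e7] at e4
  rw [e]
  filter_upwards [e1, e2, e3, e4, e5] with ω e1 e2 e3 e4 e5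
  rw [e1, Pi.add_apply, e2, Pi.smul_apply', e3, e6, cutoffDrift_succ, e4, Pi.sub_apply,
    cutoffTransform]
  have e5' : (P[fun ω => a i ω • f ω|𝒢 i]) ω = a i ω • (P[f|𝒢 i]) ω := e5
  rw [e5']
  module

lemma Cutoff.martingale_transform [CompleteSpace E] [IsFiniteMeasure P] (h : Cutoff 𝒢 a b)
    (hf : Integrable f P) : Martingale (cutoffTransform P 𝒢 a b f) 𝒢 P :=
  martingale_nat (fun i => h.stronglyMeasurable_transform i) (fun i => h.integrable_transform i)
    fun i => (h.condExp_transform_succ hf i).symm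

lemma Cutoff.transform_condExp [CompleteSpace E] [IsFiniteMeasure P] (h : Cutoff 𝒢 a b)
    (hf : Integrable f P) (i : ℕ) :
    cutoffTransform P 𝒢 a b (P[f|𝒢 i]) i =ᵐ[P] cutoffTransform P 𝒢 a b f i := by
  have e1 : ∀ᵐ ω ∂P, ∀ j ≤ i, (P[P[f|𝒢 i]|𝒢 j]) ω = (P[f|𝒢 j]) ω :=
    ae_all_iff.2 fun j => (eventually_imp_distrib_left.2 fun hj =>
      condExp_condExp_of_le (𝒢.mono hj) (𝒢.le i))
  have e2 : ∀ᵐ ω ∂P, ∀ j < i, (P[fun ω => (a j ω - a (j + 1) ω) • (P[f|𝒢 i]) ω|𝒢 j]) ω =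
      (P[fun ω => (a j ω - a (j + 1) ω) • f ω|𝒢 j]) ω :=
    ae_all_iff.2 fun j => (eventually_imp_distrib_left.2 fun hj =>
      condExp_smul_condExp (𝒢.mono hj.le) (𝒢.le i) ((h.sub_meas j).mono (𝒢.mono hj)) hf
        (h.integrable_sub_smul hf j))
  filter_upwards [e1, e2] with ω e1 e2
  unfold cutoffTransform cutoffDrift
  rw [e1 i le_rfl]
  congr 1
  refine Finset.sum_congr rfl fun j hj => ?_
  rw [e1 j (Finset.mem_range.1 hj).le, e2 j (Finset.mem_range.1 hj)]

lemma Cutoff.norm_transform_le [CompleteSpace E] (h : Cutoff 𝒢 a b)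
    (i : ℕ) : ∀ᵐ ω ∂P, ‖cutoffTransform P 𝒢 a b f i ω‖ ≤
      cutoffTransform P 𝒢 a b (fun ω => ‖f ω‖) i ω := by
  have e1 : ∀ᵐ ω ∂P, ∀ j, ‖(P[f|𝒢 j]) ω‖ ≤ (P[fun ω => ‖f ω‖|𝒢 j]) ω :=
    ae_all_iff.2 fun j => norm_condExp_le f
  have e2 : ∀ᵐ ω ∂P, ∀ j, ‖(P[fun ω => (a j ω - a (j + 1) ω) • f ω|𝒢 j]) ω‖ ≤
      (P[fun ω => (a j ω - a (j + 1) ω) • ‖f ω‖|𝒢 j]) ω := by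
    refine ae_all_iff.2 fun j => ?_
    have : (fun ω => ‖(a j ω - a (j + 1) ω) • f ω‖) =
        fun ω => (a j ω - a (j + 1) ω) • ‖f ω‖ := by
      ext ω
      rw [norm_smul, Real.norm_of_nonneg (sub_nonneg.2 (h.a_succ_le j ω)), smul_eq_mul]
    rw [← this]
    exact norm_condExp_le _
  filter_upwards [e1, e2] with ω e1 e2
  have hc : ∀ (c : ℝ) (x : E) (y : ℝ), 0 ≤ c → ‖x‖ ≤ y → ‖c • x‖ ≤ c • y := fun c x y hc hx => by
    rw [norm_smul, Real.norm_of_nonneg hc]; exact mul_le_mul_of_nonneg_left hx hc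
  refine norm_add_le_of_le ?_ (hc _ _ _ (mul_nonneg (h.b_nonneg i ω) (h.a_nonneg i ω)) (e1 i))
  refine norm_sum_le_of_le _ fun j _ => norm_add_le_of_le ?_ ?_
  · exact hc _ _ _ (mul_nonneg (sub_nonneg.2 (h.b_succ_le j ω)) (h.a_nonneg j ω)) (e1 j)
  · exact hc _ _ _ (h.b_nonneg _ ω) (e2 j)

lemma cutoffTransform_congr_ae [CompleteSpace E] (i : ℕ) (hfg : f =ᵐ[P] g) :
    cutoffTransform P 𝒢 a b f i =ᵐ[P] cutoffTransform P 𝒢 a b g i := by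
  have e1 : ∀ᵐ ω ∂P, ∀ j, (P[f|𝒢 j]) ω = (P[g|𝒢 j]) ω :=
    ae_all_iff.2 fun j => condExp_congr_ae hfg
  have e2 : ∀ᵐ ω ∂P, ∀ j, (P[fun ω => (a j ω - a (j + 1) ω) • f ω|𝒢 j]) ω =
      (P[fun ω => (a j ω - a (j + 1) ω) • g ω|𝒢 j]) ω :=
    ae_all_iff.2 fun j => condExp_congr_ae (hfg.mono fun ω hω => by simp only [hω])
  filter_upwards [e1, e2] with ω e1 e2
  simp only [cutoffTransform, cutoffDrift, e1, e2]

lemma Cutoff.transform_add [CompleteSpace E] (h : Cutoff 𝒢 a b) (hf : Integrable f P)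
    (hg : Integrable g P) (i : ℕ) : cutoffTransform P 𝒢 a b (f + g) i =ᵐ[P]
      cutoffTransform P 𝒢 a b f i + cutoffTransform P 𝒢 a b g i := by
  have e1 : ∀ᵐ ω ∂P, ∀ j, (P[f + g|𝒢 j]) ω = (P[f|𝒢 j]) ω + (P[g|𝒢 j]) ω :=
    ae_all_iff.2 fun j => condExp_add hf hg _
  have e2 : ∀ᵐ ω ∂P, ∀ j, (P[fun ω => (a j ω - a (j + 1) ω) • (f + g) ω|𝒢 j]) ω =
      (P[fun ω => (a j ω - a (j + 1) ω) • f ω|𝒢 j]) ω +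
      (P[fun ω => (a j ω - a (j + 1) ω) • g ω|𝒢 j]) ω := by
    refine ae_all_iff.2 fun j => ?_
    have : (fun ω => (a j ω - a (j + 1) ω) • (f + g) ω) =
      (fun ω => (a j ω - a (j + 1) ω) • f ω) + fun ω => (a j ω - a (j + 1) ω) • g ω := by
      ext ω; simp [smul_add]
    rw [this]
    exact condExp_add (h.integrable_sub_smul hf j) (h.integrable_sub_smul hg j) _
  filter_upwards [e1, e2] with ω e1 e2
  rw [Pi.add_apply]
  simp only [cutoffTransform, cutoffDrift, e1, e2, smul_add, Finset.sum_add_distrib]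
  abel

lemma Cutoff.transform_comp [CompleteSpace E] [CompleteSpace F] (h : Cutoff 𝒢 a b)
    (hf : Integrable f P) (L : E →L[ℝ] F) (i : ℕ) :
    cutoffTransform P 𝒢 a b (L ∘ f) i =ᵐ[P] L ∘ cutoffTransform P 𝒢 a b f i := by
  have e1 : ∀ᵐ ω ∂P, ∀ j, (P[L ∘ f|𝒢 j]) ω = L ((P[f|𝒢 j]) ω) :=
    ae_all_iff.2 fun j => (L.comp_condExp_comm hf).symm
  have e2 : ∀ᵐ ω ∂P, ∀ j, (P[fun ω => (a j ω - a (j + 1) ω) • (L ∘ f) ω|𝒢 j]) ω =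
      L ((P[fun ω => (a j ω - a (j + 1) ω) • f ω|𝒢 j]) ω) := by
    refine ae_all_iff.2 fun j => ?_
    have : (fun ω => (a j ω - a (j + 1) ω) • (L ∘ f) ω) =
      L ∘ fun ω => (a j ω - a (j + 1) ω) • f ω := by
      ext ω; simp
    rw [this]
    exact (L.comp_condExp_comm (h.integrable_sub_smul hf j)).symm
  filter_upwards [e1, e2] with ω e1 e2
  rw [Function.comp_apply]
  simp only [cutoffTransform, cutoffDrift, e1, e2, map_add, map_sum, map_smul]

lemma Cutoff.integral_transform_le [IsFiniteMeasure P] (h : Cutoff 𝒢 a b)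
    {φ : Ω → ℝ} (hφ : Integrable φ P) (hφ0 : 0 ≤ φ) (i : ℕ) :
    ∫ ω, cutoffTransform P 𝒢 a b φ i ω ∂P ≤ ∫ ω, φ ω ∂P := by
  rw [← integral_condExp (𝒢.le 0), integral_congr_ae
    ((h.martingale_transform hφ).condExp_ae_eq (Nat.zero_le i)),
    ← integral_condExp (𝒢.le 0) (f := φ)]
  refine integral_mono_ae (h.integrable_transform 0) integrable_condExp ?_
  filter_upwards [condExp_nonneg (m := 𝒢 0) (ae_of_all P hφ0)] with ω hω
  simp only [cutoffTransform, cutoffDrift, Finset.range_zero, Finset.sum_empty, zero_add,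
    smul_eq_mul]
  exact mul_le_of_le_one_left hω (mul_le_one₀ (h.b_le_one 0 ω) (h.a_nonneg 0 ω) (h.a_le_one 0 ω))

lemma Cutoff.eLpNorm_transform_le [CompleteSpace E] [IsFiniteMeasure P] (h : Cutoff 𝒢 a b)
    (hf : Integrable f P) (i : ℕ) :
    eLpNorm (cutoffTransform P 𝒢 a b f i) 1 P ≤ eLpNorm f 1 P := by
  rw [eLpNorm_one_eq_lintegral_enorm, eLpNorm_one_eq_lintegral_enorm,
    ← ofReal_integral_norm_eq_lintegral_enorm (h.integrable_transform i),
    ← ofReal_integral_norm_eq_lintegral_enorm hf]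
  refine ENNReal.ofReal_le_ofReal ?_
  exact (integral_mono_ae (h.integrable_transform i).norm (h.integrable_transform i)
    (h.norm_transform_le i)).trans (h.integral_transform_le hf.norm (fun ω => norm_nonneg _) i)

lemma Cutoff.eLpNorm_transform_sub_le [CompleteSpace E] [IsFiniteMeasure P] (h : Cutoff 𝒢 a b)
    (hf : Integrable f P) (hg : Integrable g P) (i : ℕ) :
    eLpNorm (cutoffTransform P 𝒢 a b f i - cutoffTransform P 𝒢 a b g i) 1 P ≤
      eLpNorm (f - g) 1 P := by
  refine (eLpNorm_congr_ae ?_).trans_le (h.eLpNorm_transform_le (hf.sub hg) i)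
  have := h.transform_add (hf.sub hg) hg i
  rw [sub_add_cancel] at this
  filter_upwards [this] with ω hω
  simp [hω]

lemma Cutoff.transform_sum [CompleteSpace E] (h : Cutoff 𝒢 a b) {ι : Type*} (s : Finset ι)
    {F : ι → Ω → E} (hF : ∀ k ∈ s, Integrable (F k) P) (i : ℕ) :
    cutoffTransform P 𝒢 a b (fun ω => ∑ k ∈ s, F k ω) i =ᵐ[P]
      fun ω => ∑ k ∈ s, cutoffTransform P 𝒢 a b (F k) i ω := by
  induction s using Finset.induction_on with
  | empty =>
    refine .of_forall fun ω => ?_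
    have h0 : (fun _ : Ω => (0 : E)) = 0 := rfl
    simp [cutoffTransform, cutoffDrift, h0]
  | insert k s hk ih =>
    have h1 := h.transform_add (hF k (Finset.mem_insert_self k s))
      (integrable_finsetSum s fun j hj => hF j (Finset.mem_insert_of_mem hj)) i
    have h2 := ih fun j hj => hF j (Finset.mem_insert_of_mem hj)
    simp only [Finset.sum_insert hk]
    exact h1.trans (h2.mono fun ω hω => by simp [hω])

/-- The transform of a simple function in terms of transforms of indicators. -/
lemma Cutoff.transform_simpleFunc [CompleteSpace E] [IsFiniteMeasure P] (h : Cutoff 𝒢 a b)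
    (s : SimpleFunc Ω E) (i : ℕ) : cutoffTransform P 𝒢 a b s i =ᵐ[P]
      fun ω => ∑ x ∈ s.range,
        cutoffTransform P 𝒢 a b ((s ⁻¹' {x}).indicator (1 : Ω → ℝ)) i ω • x := by
  have hs : ⇑s = fun ω => ∑ x ∈ s.range,
      (ContinuousLinearMap.toSpanSingleton ℝ x ∘ (s ⁻¹' {x}).indicator (1 : Ω → ℝ)) ω := by
    ext ω
    simp only [Function.comp, ContinuousLinearMap.toSpanSingleton_apply]
    rw [Finset.sum_eq_single_of_mem (s ω) (s.mem_range_self ω)]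
    · simp
    · intro x _ hx
      rw [Set.indicator_of_notMem (by simpa using hx.symm), zero_smul]
  have hi : ∀ x, Integrable ((s ⁻¹' {x}).indicator (1 : Ω → ℝ)) P := fun x =>
    (integrable_const 1).indicator (s.measurableSet_fiber x)
  have h1 := h.transform_sum s.range (F := fun x =>
    ContinuousLinearMap.toSpanSingleton ℝ x ∘ (s ⁻¹' {x}).indicator 1)
    (fun x _ => (ContinuousLinearMap.toSpanSingleton ℝ x).integrable_comp (hi x)) i
  rw [← hs] at h1
  refine h1.trans ?_
  have h2 : ∀ᵐ ω ∂P, ∀ x ∈ s.range, cutoffTransform P 𝒢 a b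
      (ContinuousLinearMap.toSpanSingleton ℝ x ∘ (s ⁻¹' {x}).indicator 1) i ω =
      cutoffTransform P 𝒢 a b ((s ⁻¹' {x}).indicator 1) i ω • x :=
    (Finset.eventually_all s.range).2 fun x _ =>
      (h.transform_comp (hi x) (ContinuousLinearMap.toSpanSingleton ℝ x) i).mono fun ω hω => by
        simpa using hω
  exact h2.mono fun ω hω => Finset.sum_congr rfl hω

end CutoffTransform

section DualDoob

variable {Ω : Type*} {m : MeasurableSpace Ω} {P : Measure Ω}

lemma add_rpow_le_rpow_add_mul {p : ℝ} (hp : 1 ≤ p) {x v : ℝ} (hx : 0 ≤ x) (hv : 0 ≤ v) :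
    (x + v) ^ p ≤ x ^ p + p * ((x + v) ^ (p - 1) * v) := by
  rcases (add_nonneg hx hv).eq_or_lt with h0 | h0
  · rw [← h0, Real.zero_rpow (by linarith)]
    positivity
  have h1 := one_add_mul_self_le_rpow_one_add (s := -v / (x + v))
    (by rw [le_div_iff₀ h0]; linarith) hp
  have h2 : 1 + -v / (x + v) = x / (x + v) := by field_simp; ring
  rw [h2, Real.div_rpow hx h0.le, le_div_iff₀ (by positivity)] at h1
  have h3 : (x + v) ^ p = (x + v) ^ (p - 1) * (x + v) := by
    rw [← Real.rpow_add_one h0.ne']; ring_nf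
  have h4 : (1 + p * (-v / (x + v))) * (x + v) ^ p =
      (x + v) ^ p - p * ((x + v) ^ (p - 1) * v) := by
    rw [h3]; field_simp; ring
  linarith

lemma lintegral_mul_condExp [IsFiniteMeasure P] {𝒢 : MeasurableSpace Ω} (h𝒢 : 𝒢 ≤ m)
    {ψ : Ω → ℝ} (hψ : Integrable ψ P) (hψ0 : 0 ≤ ψ) {c : Ω → ℝ≥0∞} (hc : Measurable[𝒢] c) :
    ∫⁻ ω, c ω * ENNReal.ofReal ((P[ψ|𝒢]) ω) ∂P = ∫⁻ ω, c ω * ENNReal.ofReal (ψ ω) ∂P := by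
  have hE : AEMeasurable (fun ω => ENNReal.ofReal ((P[ψ|𝒢]) ω)) P :=
    (stronglyMeasurable_condExp.mono h𝒢).measurable.ennreal_ofReal.aemeasurable
  have hψm : AEMeasurable (fun ω => ENNReal.ofReal (ψ ω)) P :=
    hψ.aestronglyMeasurable.aemeasurable.ennreal_ofReal
  have key : (P.withDensity fun ω => ENNReal.ofReal ((P[ψ|𝒢]) ω)).trim h𝒢 =
      (P.withDensity fun ω => ENNReal.ofReal (ψ ω)).trim h𝒢 := by
    refine @Measure.ext _ 𝒢 _ _ fun s hs => ?_
    rw [trim_measurableSet_eq h𝒢 hs, trim_measurableSet_eq h𝒢 hs,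
      withDensity_apply _ (h𝒢 s hs), withDensity_apply _ (h𝒢 s hs),
      ← ofReal_integral_eq_lintegral_ofReal hψ.integrableOn (.of_forall hψ0),
      ← ofReal_integral_eq_lintegral_ofReal integrable_condExp.integrableOn
        (ae_restrict_of_ae (condExp_nonneg (.of_forall hψ0))), setIntegral_condExp h𝒢 hψ hs]
  have h1 := lintegral_withDensity_eq_lintegral_mul₀ hE (hc.mono h𝒢 le_rfl).aemeasurable
  have h2 := lintegral_withDensity_eq_lintegral_mul₀ hψm (hc.mono h𝒢 le_rfl).aemeasurable
  simp only [Pi.mul_apply, mul_comm _ (c _)] at h1 h2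
  rw [← h1, ← h2, ← lintegral_trim h𝒢 hc, ← lintegral_trim h𝒢 hc, key]

/-- The dual Doob inequality. -/
lemma eLpNorm_sum_abs_condExp_le [IsFiniteMeasure P] (𝒢 : Filtration ℕ m) {p : ℝ} (hp : 1 ≤ p)
    {ψ : ℕ → Ω → ℝ} {Ψ : Ω → ℝ} (hΨ : MemLp Ψ (ENNReal.ofReal p) P)
    (hψ : ∀ j, AEStronglyMeasurable (ψ j) P) (hψ0 : ∀ j, 0 ≤ ψ j) (N : ℕ)
    (hN : ∀ᵐ ω ∂P, ∑ j ∈ Finset.range N, ψ j ω ≤ Ψ ω) :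
    eLpNorm (fun ω => ∑ j ∈ Finset.range N, |(P[ψ j|𝒢 j]) ω|) (ENNReal.ofReal p) P ≤
      ENNReal.ofReal p * eLpNorm Ψ (ENNReal.ofReal p) P := by
  have hp0 : 0 < p := by linarith
  have hp1 : (1 : ℝ≥0∞) ≤ ENNReal.ofReal p := by simpa using ENNReal.ofReal_le_ofReal hp
  set W : ℕ → Ω → ℝ := fun k ω => ∑ j ∈ Finset.range k, |(P[ψ j|𝒢 j]) ω| with hW
  have hW0 : ∀ k ω, 0 ≤ W k ω := fun k ω => Finset.sum_nonneg fun _ _ => abs_nonneg _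
  have hWmono : ∀ {k l} ω, k ≤ l → W k ω ≤ W l ω := fun ω hkl =>
    Finset.sum_le_sum_of_subset_of_nonneg (Finset.range_subset_range.2 hkl)
      fun _ _ _ => abs_nonneg _
  have hψp : ∀ j ∈ Finset.range N, MemLp (ψ j) (ENNReal.ofReal p) P := fun j hj => by
    refine hΨ.mono (hψ j) (hN.mono fun ω hω => ?_)
    have h1 := Finset.single_le_sum (f := fun j => ψ j ω) (fun j _ => hψ0 j ω) hj
    rw [Real.norm_of_nonneg (hψ0 j ω)]
    exact (h1.trans hω).trans (le_abs_self _)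
  have hWp : MemLp (W N) (ENNReal.ofReal p) P :=
    memLp_finsetSum _ fun j hj => ((hψp j hj).condExp hp1).abs
  have hWm : ∀ k, StronglyMeasurable[𝒢 k] (W (k + 1)) := fun k =>
    Finset.stronglyMeasurable_fun_sum _ fun j hj =>
      continuous_abs.comp_stronglyMeasurable
        (stronglyMeasurable_condExp.mono (𝒢.mono (Nat.lt_succ_iff.1 (Finset.mem_range.1 hj))))
  have hstep : ∀ k ω, W k ω ^ p ≤
      ∑ j ∈ Finset.range k, p * (W (j + 1) ω ^ (p - 1) * |(P[ψ j|𝒢 j]) ω|) := by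
    intro k ω
    induction k with
    | zero => simp [hW, hp0.ne']
    | succ k ih =>
      rw [Finset.sum_range_succ]
      have e : W (k + 1) ω = W k ω + |(P[ψ k|𝒢 k]) ω| := Finset.sum_range_succ _ _
      have := add_rpow_le_rpow_add_mul hp (hW0 k ω) (abs_nonneg ((P[ψ k|𝒢 k]) ω))
      rw [← e] at this
      linarith
  have hmain : ∫⁻ ω, ENNReal.ofReal (W N ω) ^ p ∂P ≤ ENNReal.ofReal p *
      ∫⁻ ω, ENNReal.ofReal (W N ω) ^ (p - 1) * ENNReal.ofReal (Ψ ω) ∂P := by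
    calc ∫⁻ ω, ENNReal.ofReal (W N ω) ^ p ∂P
        ≤ ∫⁻ ω, ∑ j ∈ Finset.range N, ENNReal.ofReal p * (ENNReal.ofReal (W (j + 1) ω) ^ (p - 1) *
            ENNReal.ofReal (|(P[ψ j|𝒢 j]) ω|)) ∂P := by
          refine lintegral_mono fun ω => ?_
          rw [ENNReal.ofReal_rpow_of_nonneg (hW0 N ω) hp0.le]
          refine (ENNReal.ofReal_le_ofReal (hstep N ω)).trans_eq ?_
          have hn : ∀ j, 0 ≤ W (j + 1) ω ^ (p - 1) := fun j => Real.rpow_nonneg (hW0 _ ω) _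
          rw [ENNReal.ofReal_sum_of_nonneg fun j _ => mul_nonneg hp0.le
            (mul_nonneg (hn j) (abs_nonneg _))]
          refine Finset.sum_congr rfl fun j _ => ?_
          rw [ENNReal.ofReal_mul hp0.le, ENNReal.ofReal_mul (hn j),
            ENNReal.ofReal_rpow_of_nonneg (hW0 _ ω) (by linarith)]
      _ = ∑ j ∈ Finset.range N, ENNReal.ofReal p * ∫⁻ ω, ENNReal.ofReal (W (j + 1) ω) ^ (p - 1) *
            ENNReal.ofReal ((P[ψ j|𝒢 j]) ω) ∂P := by
          rw [lintegral_finsetSum']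
          · refine Finset.sum_congr rfl fun j _ => ?_
            rw [lintegral_const_mul']
            · congr 1
              refine lintegral_congr_ae ?_
              filter_upwards [condExp_nonneg (m := 𝒢 j) (ae_of_all P (hψ0 j))] with ω hω
              rw [abs_of_nonneg hω]
            · exact ENNReal.ofReal_ne_top
          · intro j _
            have h1 := ((hWm j).mono (𝒢.le j)).measurable
            have h2 := ((stronglyMeasurable_condExp (f := ψ j) (μ := P) (m := 𝒢 j)).mono
              (𝒢.le j)).measurable
            exact (((h1.ennreal_ofReal.pow_const _).mul
              (measurable_norm.comp h2).ennreal_ofReal).const_mul _).aemeasurable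
      _ = ∑ j ∈ Finset.range N, ENNReal.ofReal p * ∫⁻ ω, ENNReal.ofReal (W (j + 1) ω) ^ (p - 1) *
            ENNReal.ofReal (ψ j ω) ∂P := by
          refine Finset.sum_congr rfl fun j hj => ?_
          rw [lintegral_mul_condExp (𝒢.le j) ((hψp j hj).integrable hp1) (hψ0 j)
            ((hWm j).measurable.ennreal_ofReal.pow_const _)]
      _ ≤ ∑ j ∈ Finset.range N, ENNReal.ofReal p * ∫⁻ ω, ENNReal.ofReal (W N ω) ^ (p - 1) *
            ENNReal.ofReal (ψ j ω) ∂P := by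
          refine Finset.sum_le_sum fun j hj => mul_le_mul_right (lintegral_mono fun ω => ?_) _
          refine mul_le_mul_left (ENNReal.rpow_le_rpow (ENNReal.ofReal_le_ofReal
            (hWmono ω ?_)) (by linarith)) _
          exact Finset.mem_range.1 hj
      _ = ENNReal.ofReal p * ∫⁻ ω, ∑ j ∈ Finset.range N, ENNReal.ofReal (W N ω) ^ (p - 1) *
            ENNReal.ofReal (ψ j ω) ∂P := by
          rw [lintegral_finsetSum', Finset.mul_sum]
          intro j _
          exact (hWp.aestronglyMeasurable.aemeasurable.ennreal_ofReal.pow_const _).mul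
            (hψ j).aemeasurable.ennreal_ofReal
      _ ≤ _ := by
          refine mul_le_mul_right (lintegral_mono_ae (hN.mono fun ω hω => ?_)) _
          rw [← Finset.mul_sum, ← ENNReal.ofReal_sum_of_nonneg fun j _ => hψ0 j ω]
          exact mul_le_mul_right (ENNReal.ofReal_le_ofReal hω) _
  have hfin := hWp.eLpNorm_lt_top
  change eLpNorm (W N) (ENNReal.ofReal p) P ≤ _
  rw [eLpNorm_eq_lintegral_rpow_enorm_toReal (by simpa using hp0) ENNReal.ofReal_ne_top,
    ENNReal.toReal_ofReal hp0.le] at hfin ⊢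
  rw [eLpNorm_eq_lintegral_rpow_enorm_toReal (by simpa using hp0) ENNReal.ofReal_ne_top,
    ENNReal.toReal_ofReal hp0.le]
  have hWe : ∀ ω, ‖W N ω‖ₑ = ENNReal.ofReal (W N ω) := fun ω => Real.enorm_of_nonneg (hW0 N ω)
  have hΨe : ∀ ω, ENNReal.ofReal (Ψ ω) ≤ ‖Ψ ω‖ₑ := fun ω => Real.ofReal_le_enorm _
  simp only [hWe] at hfin ⊢
  set A := ∫⁻ ω, ENNReal.ofReal (W N ω) ^ p ∂P with hA
  set B := ∫⁻ ω, ‖Ψ ω‖ₑ ^ p ∂P with hB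
  have hA_top : A ≠ ⊤ := fun h => by
    rw [h, ENNReal.top_rpow_of_pos (by positivity)] at hfin
    exact lt_irrefl _ hfin
  rcases hp.eq_or_lt with rfl | hp'
  · simp only [sub_self, ENNReal.rpow_zero, one_mul, ENNReal.ofReal_one] at hmain
    simp only [ne_eq, one_ne_zero, not_false_eq_true, div_self, ENNReal.rpow_one,
      ENNReal.ofReal_one, one_mul]
    refine hmain.trans (lintegral_mono fun ω => ?_)
    simpa using hΨe ω
  have hpq := Real.HolderConjugate.conjExponent hp'
  set q := p.conjExponent
  have hH : ∫⁻ ω, ENNReal.ofReal (W N ω) ^ (p - 1) * ENNReal.ofReal (Ψ ω) ∂P ≤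
      A ^ (1 / q) * B ^ (1 / p) := by
    have := ENNReal.lintegral_mul_le_Lp_mul_Lq P hpq.symm
      (hWp.aestronglyMeasurable.aemeasurable.ennreal_ofReal.pow_const (p - 1))
      hΨ.aestronglyMeasurable.aemeasurable.enorm
    have e : ∀ ω, (ENNReal.ofReal (W N ω) ^ (p - 1)) ^ q = ENNReal.ofReal (W N ω) ^ p := fun ω => by
      rw [← ENNReal.rpow_mul, hpq.sub_one_mul_conj]
    simp only [e] at this
    refine le_trans (lintegral_mono fun ω => ?_) this
    exact mul_le_mul_right (hΨe ω) _
  rcases eq_or_ne A 0 with hA0 | hA0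
  · rw [hA0, ENNReal.zero_rpow_of_pos (by positivity)]
    exact zero_le
  have hAq0 : A ^ (1 / q) ≠ 0 := (ENNReal.rpow_pos (pos_iff_ne_zero.2 hA0) hA_top).ne'
  have hAqt : A ^ (1 / q) ≠ ⊤ := ENNReal.rpow_ne_top_of_nonneg (by
    have := hpq.symm.pos; positivity) hA_top
  rw [← ENNReal.mul_le_mul_iff_right hAq0 hAqt, ← ENNReal.rpow_add _ _ hA0 hA_top]
  have e1 : 1 / q + 1 / p = 1 := by
    have := hpq.inv_add_inv_eq_one; rw [one_div, one_div, add_comm]; exact this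
  rw [e1, ENNReal.rpow_one]
  calc A ≤ _ := hmain
    _ ≤ ENNReal.ofReal p * (A ^ (1 / q) * B ^ (1 / p)) := mul_le_mul_right hH _
    _ = _ := by ring

end DualDoob

section CutoffBounds

variable {Ω E : Type*} {m : MeasurableSpace Ω} {P : Measure Ω}
  [NormedAddCommGroup E]

/-- The indicator of the event that the process `x` has stayed below level `c`. -/
def levelCutoff (x : ℕ → Ω → E) (c : ℝ) (j : ℕ) (ω : Ω) : ℝ :=
  if ∀ l ≤ j, ‖x l ω‖ < c then 1 else 0

/-- The sum of the conditional expected masses of `g` removed by the cutoff `a`. -/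
def removedMass (P : Measure Ω) (𝒢 : Filtration ℕ m) (a : ℕ → Ω → ℝ) (g : Ω → ℝ) (k : ℕ)
    (ω : Ω) : ℝ :=
  ∑ j ∈ Finset.range k, |(P[fun ω => (a j ω - a (j + 1) ω) * g ω|𝒢 j]) ω|

/-- The indicator of the event that the removed mass has stayed below level `K`. -/
def massCutoff (P : Measure Ω) (𝒢 : Filtration ℕ m) (a : ℕ → Ω → ℝ) (g : Ω → ℝ) (K : ℝ) (k : ℕ)
    (ω : Ω) : ℝ :=
  if removedMass P 𝒢 a g k ω ≤ K then 1 else 0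

variable {𝒢 : Filtration ℕ m} {a b : ℕ → Ω → ℝ} {g : Ω → ℝ} {x : ℕ → Ω → E} {c K : ℝ}

lemma removedMass_succ (k : ℕ) (ω : Ω) : removedMass P 𝒢 a g (k + 1) ω =
    removedMass P 𝒢 a g k ω + |(P[fun ω => (a k ω - a (k + 1) ω) * g ω|𝒢 k]) ω| :=
  Finset.sum_range_succ _ _

lemma removedMass_mono (ω : Ω) : Monotone fun k => removedMass P 𝒢 a g k ω :=
  monotone_nat_of_le_succ fun k => by
    rw [removedMass_succ]; exact le_add_of_nonneg_right (abs_nonneg _)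

lemma stronglyMeasurable_removedMass_succ (k : ℕ) :
    StronglyMeasurable[𝒢 k] (removedMass P 𝒢 a g (k + 1)) :=
  Finset.stronglyMeasurable_fun_sum _ fun _ hj => continuous_abs.comp_stronglyMeasurable
    (stronglyMeasurable_condExp.mono (𝒢.mono (Nat.lt_succ_iff.1 (Finset.mem_range.1 hj))))

lemma cutoff_levelCutoff_massCutoff (hx : ∀ j, StronglyMeasurable[𝒢 j] (x j)) (hK : 0 ≤ K) :
    Cutoff 𝒢 (levelCutoff x c) (massCutoff P 𝒢 (levelCutoff x c) g K) where
  a_meas i := by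
    refine StronglyMeasurable.ite ?_ stronglyMeasurable_const stronglyMeasurable_const
    simp only [Set.ofPred_forall]
    refine MeasurableSet.iInter fun l => MeasurableSet.iInter fun hl => ?_
    exact StronglyMeasurable.measurableSet_lt ((hx l).norm.mono (𝒢.mono hl))
      stronglyMeasurable_const
  b_zero_meas := by
    have : massCutoff P 𝒢 (levelCutoff x c) g K 0 = fun _ => 1 := by
      ext ω; simp [massCutoff, removedMass, hK]
    rw [this]; exact stronglyMeasurable_const
  b_succ_meas i := StronglyMeasurable.ite
    (StronglyMeasurable.measurableSet_le (stronglyMeasurable_removedMass_succ i)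
      stronglyMeasurable_const) stronglyMeasurable_const stronglyMeasurable_const
  a_nonneg i ω := by unfold levelCutoff; split_ifs <;> norm_num
  a_zero_le ω := by unfold levelCutoff; split_ifs <;> norm_num
  a_succ_le i ω := by
    unfold levelCutoff
    split_ifs with h1 h2
    · exact le_rfl
    · exact absurd (fun l hl => h1 l (hl.trans i.le_succ)) h2
    · exact zero_le_one
    · exact le_rfl
  b_nonneg i ω := by unfold massCutoff; split_ifs <;> norm_num
  b_zero_le ω := by unfold massCutoff; split_ifs <;> norm_num
  b_succ_le i ω := by
    unfold massCutoff
    split_ifs with h1 h2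
    · exact le_rfl
    · exact absurd ((removedMass_mono ω i.le_succ).trans h1) h2
    · exact zero_le_one
    · exact le_rfl

lemma sum_massCutoff_mul_le (hK : 0 ≤ K) (k : ℕ) (ω : Ω) :
    ∑ j ∈ Finset.range k, massCutoff P 𝒢 a g K (j + 1) ω *
      |(P[fun ω => (a j ω - a (j + 1) ω) * g ω|𝒢 j]) ω| ≤ K := by
  induction k with
  | zero => simpa using hK
  | succ k ih =>
    by_cases h : removedMass P 𝒢 a g (k + 1) ω ≤ K
    · refine le_trans (Finset.sum_le_sum fun j _ => ?_) h
      refine mul_le_of_le_one_left (abs_nonneg _) ?_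
      unfold massCutoff; split_ifs <;> norm_num
    · rw [Finset.sum_range_succ]
      simp only [massCutoff, if_neg h, zero_mul, add_zero] at ih ⊢
      exact ih

lemma Cutoff.norm_condExp_sub_smul_le [NormedSpace ℝ E] [CompleteSpace E] [IsFiniteMeasure P]
    (h : Cutoff 𝒢 a b) (hg : Integrable g P) {f : Ω → E} (hf : Integrable f P)
    (hfg : ∀ᵐ ω ∂P, ‖f ω‖ ≤ g ω) :
    ∀ᵐ ω ∂P, ∀ j, ‖(P[fun ω => (a j ω - a (j + 1) ω) • f ω|𝒢 j]) ω‖ ≤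
      |(P[fun ω => (a j ω - a (j + 1) ω) * g ω|𝒢 j]) ω| := by
  refine ae_all_iff.2 fun j => ?_
  have h2 := condExp_mono (m := 𝒢 j) (h.integrable_sub_smul hf j).norm
    (h.integrable_sub_smul hg j) (hfg.mono fun ω hω => by
      beta_reduce
      rw [norm_smul, Real.norm_of_nonneg (sub_nonneg.2 (h.a_succ_le j ω)), smul_eq_mul]
      exact mul_le_mul_of_nonneg_left hω (sub_nonneg.2 (h.a_succ_le j ω)))
  filter_upwards [norm_condExp_le (m := 𝒢 j) fun ω => (a j ω - a (j + 1) ω) • f ω, h2]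
    with ω h1 h2
  exact (h1.trans h2).trans (le_abs_self _)

lemma Cutoff.norm_transform_le_add [NormedSpace ℝ E] [CompleteSpace E] [IsFiniteMeasure P]
    (h : Cutoff 𝒢 a (massCutoff P 𝒢 a g K)) (hK : 0 ≤ K) (hc : 0 ≤ c)
    (hg : Integrable g P) {f : Ω → E} (hf : Integrable f P) (hfg : ∀ᵐ ω ∂P, ‖f ω‖ ≤ g ω)
    {i : ℕ} (hfc : ∀ᵐ ω ∂P, ∀ j ≤ i, a j ω * ‖(P[f|𝒢 j]) ω‖ ≤ c) :
    ∀ᵐ ω ∂P, ‖cutoffTransform P 𝒢 a (massCutoff P 𝒢 a g K) f i ω‖ ≤ c + K := by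
  filter_upwards [h.norm_condExp_sub_smul_le hg hf hfg, hfc] with ω h1 h2
  set β := fun j => massCutoff P 𝒢 a g K j ω
  have h3 : ‖cutoffDrift P 𝒢 a (massCutoff P 𝒢 a g K) f i ω‖ ≤
      ∑ j ∈ Finset.range i, ((β j - β (j + 1)) * c +
        β (j + 1) * |(P[fun ω => (a j ω - a (j + 1) ω) * g ω|𝒢 j]) ω|) := by
    refine norm_sum_le_of_le _ fun j hj => norm_add_le_of_le ?_ ?_
    · rw [norm_smul, norm_mul, Real.norm_of_nonneg (sub_nonneg.2 (h.b_succ_le j ω)),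
        Real.norm_of_nonneg (h.a_nonneg j ω), mul_assoc]
      exact mul_le_mul_of_nonneg_left (h2 j (Finset.mem_range.1 hj).le)
        (sub_nonneg.2 (h.b_succ_le j ω))
    · rw [norm_smul, Real.norm_of_nonneg (h.b_nonneg _ ω)]
      exact mul_le_mul_of_nonneg_left (h1 j) (h.b_nonneg _ ω)
  have h4 : ‖(β i * a i ω) • (P[f|𝒢 i]) ω‖ ≤ β i * c := by
    rw [norm_smul, norm_mul, Real.norm_of_nonneg (h.b_nonneg i ω),
      Real.norm_of_nonneg (h.a_nonneg i ω), mul_assoc]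
    exact mul_le_mul_of_nonneg_left (h2 i le_rfl) (h.b_nonneg _ ω)
  have h5 := norm_add_le_of_le h3 h4
  rw [Finset.sum_add_distrib, ← Finset.sum_mul, Finset.sum_range_sub'] at h5
  have h6 := sum_massCutoff_mul_le (P := P) (𝒢 := 𝒢) (a := a) (g := g) hK i ω
  have h7 : β 0 * c ≤ c := mul_le_of_le_one_left hc (h.b_zero_le ω)
  refine h5.trans ?_
  linarith

lemma removedMass_eLpNorm_le [IsFiniteMeasure P] (hx : ∀ j, StronglyMeasurable[𝒢 j] (x j))
    (hxg : ∀ j, ∀ᵐ ω ∂P, ‖x j ω‖ ≤ g ω) {q : ℝ} (hq : 1 ≤ q) (hgm : StronglyMeasurable g)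
    (hg : MemLp g (ENNReal.ofReal q) P) (hg0 : 0 ≤ g) (N : ℕ) :
    eLpNorm (removedMass P 𝒢 (levelCutoff x c) g N) (ENNReal.ofReal q) P ≤
      ENNReal.ofReal q * eLpNorm ({ω | c ≤ g ω}.indicator g) (ENNReal.ofReal q) P := by
  have h := cutoff_levelCutoff_massCutoff (P := P) (g := g) (c := c) (K := 0) hx le_rfl
  have hs : MeasurableSet {ω | c ≤ g ω} :=
    StronglyMeasurable.measurableSet_le stronglyMeasurable_const hgm
  refine eLpNorm_sum_abs_condExp_le 𝒢 hq (hg.indicator hs)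
    (fun j => (((h.sub_meas j).mono (𝒢.le _)).mul hgm).aestronglyMeasurable)
    (fun j ω => mul_nonneg (sub_nonneg.2 (h.a_succ_le j ω)) (hg0 ω)) N ?_
  filter_upwards [ae_all_iff.2 hxg] with ω hω
  simp only [Pi.mul_apply]
  rw [← Finset.sum_mul, Finset.sum_range_sub']
  have h0 := h.a_le_one 0 ω
  by_cases hN : ∀ l ≤ N, ‖x l ω‖ < c
  · have : levelCutoff x c N ω = 1 := if_pos hN
    rw [this]
    exact (mul_nonpos_of_nonpos_of_nonneg (by linarith) (hg0 ω)).trans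
      (Set.indicator_nonneg (fun ω _ => hg0 ω) ω)
  · have : levelCutoff x c N ω = 0 := if_neg hN
    push Not at hN
    obtain ⟨l, -, hl⟩ := hN
    have hmem : ω ∈ {ω | c ≤ g ω} := hl.trans (hω l)
    rw [this, sub_zero, Set.indicator_of_mem hmem]
    exact mul_le_of_le_one_left (hg0 ω) h0

lemma norm_sub_cutoffTransform_le [NormedSpace ℝ E] [CompleteSpace E] [IsFiniteMeasure P]
    (hx : ∀ j, StronglyMeasurable[𝒢 j] (x j)) (hxg : ∀ j, ∀ᵐ ω ∂P, ‖x j ω‖ ≤ g ω)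
    (hg : Integrable g P) (hg0 : 0 ≤ g) (hK : 0 ≤ K) (hc : 0 ≤ c) {i N : ℕ} (hi : i ≤ N)
    {f : Ω → E} (hf : Integrable f P) (hfg : ∀ᵐ ω ∂P, ‖f ω‖ ≤ g ω)
    (hfx : ∀ j ≤ i, P[f|𝒢 j] =ᵐ[P] x j)
    (hb : ∀ᵐ ω ∂P, ‖cutoffTransform P 𝒢 (levelCutoff x c)
      (massCutoff P 𝒢 (levelCutoff x c) g K) f i ω‖ ≤ c + K) :
    ∀ᵐ ω ∂P, ‖x i ω - cutoffTransform P 𝒢 (levelCutoff x c)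
      (massCutoff P 𝒢 (levelCutoff x c) g K) f i ω‖ ≤
      {ω | c ≤ g ω}.indicator g ω + removedMass P 𝒢 (levelCutoff x c) g N ω +
        {ω | K ≤ removedMass P 𝒢 (levelCutoff x c) g N ω}.indicator (fun ω => g ω + c) ω := by
  have h := cutoff_levelCutoff_massCutoff (P := P) (g := g) (c := c) hx hK
  filter_upwards [h.norm_condExp_sub_smul_le hg hf hfg, ae_all_iff.2 hxg, hfx i le_rfl, hb]
    with ω h1 h2 h3 h4
  have hW := removedMass_mono (P := P) (𝒢 := 𝒢) (a := levelCutoff x c) (g := g) ω hi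
  simp only at hW
  have hi0 : 0 ≤ {ω | c ≤ g ω}.indicator g ω := Set.indicator_nonneg (fun ω _ => hg0 ω) ω
  have hk0 : 0 ≤ {ω | K ≤ removedMass P 𝒢 (levelCutoff x c) g N ω}.indicator
      (fun ω => g ω + c) ω := Set.indicator_nonneg (fun ω _ => add_nonneg (hg0 ω) hc) ω
  by_cases hKi : removedMass P 𝒢 (levelCutoff x c) g i ω ≤ K
  · have hb1 : ∀ j ≤ i, massCutoff P 𝒢 (levelCutoff x c) g K j ω = 1 := fun j hj =>
      if_pos ((removedMass_mono ω hj).trans hKi)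
    have e : x i ω - cutoffTransform P 𝒢 (levelCutoff x c)
        (massCutoff P 𝒢 (levelCutoff x c) g K) f i ω = (1 - levelCutoff x c i ω) • x i ω -
        ∑ j ∈ Finset.range i,
          (P[fun ω => (levelCutoff x c j ω - levelCutoff x c (j + 1) ω) • f ω|𝒢 j]) ω := by
      rw [cutoffTransform, cutoffDrift, hb1 i le_rfl, h3, one_mul, Finset.sum_congr rfl]
      rotate_left
      · intro j hj
        rw [hb1 j (Finset.mem_range.1 hj).le, hb1 (j + 1) (Finset.mem_range.1 hj), sub_self,
          zero_mul, zero_smul, zero_add, one_smul]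
      module
    rw [e]
    have h5 : ‖(1 - levelCutoff x c i ω) • x i ω‖ ≤ {ω | c ≤ g ω}.indicator g ω := by
      by_cases hN : ∀ l ≤ i, ‖x l ω‖ < c
      · have : levelCutoff x c i ω = 1 := if_pos hN
        rw [this]
        simpa using hi0
      · have : levelCutoff x c i ω = 0 := if_neg hN
        push Not at hN
        obtain ⟨l, -, hl⟩ := hN
        have hmem : ω ∈ {ω | c ≤ g ω} := hl.trans (h2 l)
        rw [this, sub_zero, Set.indicator_of_mem hmem, one_smul]
        exact h2 i
    have h6 := norm_sub_le_of_le h5 (norm_sum_le_of_le (Finset.range i) fun j _ => h1 j)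
    change _ ≤ _ + removedMass P 𝒢 (levelCutoff x c) g i ω at h6
    linarith
  · push Not at hKi
    have hmem : ω ∈ {ω | K ≤ removedMass P 𝒢 (levelCutoff x c) g N ω} := hKi.le.trans hW
    rw [Set.indicator_of_mem hmem]
    have h6 := norm_sub_le_of_le (h2 i) h4
    linarith

/-- Uniform choice of the cutoff levels. -/
lemma exists_cutoff (E : Type*) [NormedAddCommGroup E] [NormedSpace ℝ E] [CompleteSpace E]
    [IsFiniteMeasure P] {p : ℝ} (hp : 1 ≤ p) (hgm : StronglyMeasurable g)
    (hg1 : ∀ ω, 1 ≤ g ω) (hg : MemLp g (ENNReal.ofReal p) P) {ε : ℝ} (hε : 0 < ε) :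
    ∃ R : ℝ, ∀ (𝒢 : Filtration ℕ m) (x : ℕ → Ω → E), (∀ j, StronglyMeasurable[𝒢 j] (x j)) →
      (∀ j, ∀ᵐ ω ∂P, ‖x j ω‖ ≤ g ω) → ∃ a b : ℕ → Ω → ℝ, Cutoff 𝒢 a b ∧
      (∀ i (f : Ω → E), Integrable f P → (∀ᵐ ω ∂P, ‖f ω‖ ≤ g ω) →
        (∀ j ≤ i, P[f|𝒢 j] =ᵐ[P] x j) → ∀ᵐ ω ∂P, ‖cutoffTransform P 𝒢 a b f i ω‖ ≤ R) ∧
      (∀ i (f : Ω → ℝ), Integrable f P → (∀ ω, |f ω| ≤ 1) →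
        ∀ᵐ ω ∂P, |cutoffTransform P 𝒢 a b f i ω| ≤ R) ∧
      ∀ N : ℕ, ∃ Y : Ω → ℝ, AEStronglyMeasurable Y P ∧
        eLpNorm Y (ENNReal.ofReal p) P ≤ ENNReal.ofReal ε ∧
        ∀ i ≤ N, ∀ f : Ω → E, Integrable f P → (∀ᵐ ω ∂P, ‖f ω‖ ≤ g ω) →
          (∀ j ≤ i, P[f|𝒢 j] =ᵐ[P] x j) →
          ∀ᵐ ω ∂P, ‖x i ω - cutoffTransform P 𝒢 a b f i ω‖ ≤ Y ω := by
  have hp1 : (1 : ℝ≥0∞) ≤ ENNReal.ofReal p := by simpa using ENNReal.ofReal_le_ofReal hp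
  have hg0 : 0 ≤ g := fun ω => zero_le_one.trans (hg1 ω)
  have hgi : Integrable g P := hg.integrable hp1
  obtain ⟨c₀, -, hc₀⟩ := hg.eLpNorm_indicator_norm_ge_pos_le hgm
    (ε := ε / (2 * (1 + p))) (by positivity)
  set c := max c₀ 1 with hc
  have hc1 : 1 ≤ c := le_max_right _ _
  have hc0 : 0 ≤ c := zero_le_one.trans hc1
  have htail : eLpNorm ({ω | c ≤ g ω}.indicator g) (ENNReal.ofReal p) P ≤
      ENNReal.ofReal (ε / (2 * (1 + p))) := by
    refine le_trans (eLpNorm_mono fun ω => ?_) hc₀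
    by_cases hω : c ≤ g ω
    · have hω' : c₀ ≤ ‖g ω‖₊ := by
        rw [coe_nnnorm, Real.norm_of_nonneg (hg0 ω)]; exact (le_max_left _ _).trans hω
      rw [Set.indicator_of_mem (by exact hω), Set.indicator_of_mem (by exact hω')]
    · rw [Set.indicator_of_notMem (by exact hω)]
      simp
  have hgc : MemLp (fun ω => g ω + c) (ENNReal.ofReal p) P := hg.add (memLp_const c)
  obtain ⟨δ, hδ, hδs⟩ := hgc.eLpNorm_indicator_le hp1 ENNReal.ofReal_ne_top
    (ε := ε / 2) (by positivity)
  set I := eLpNorm g 1 P with hI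
  have hI_top : I ≠ ⊤ := (memLp_one_iff_integrable.2 hgi).eLpNorm_ne_top
  set K := max 1 (I.toReal / δ) with hK
  have hK1 : 1 ≤ K := le_max_left _ _
  have hK0 : 0 ≤ K := zero_le_one.trans hK1
  refine ⟨c + K, fun 𝒢 x hx hxg => ?_⟩
  have h := cutoff_levelCutoff_massCutoff (P := P) (g := g) (c := c) hx hK0
  have hbound : ∀ i (f : Ω → E), Integrable f P → (∀ᵐ ω ∂P, ‖f ω‖ ≤ g ω) →
      (∀ j ≤ i, P[f|𝒢 j] =ᵐ[P] x j) → ∀ᵐ ω ∂P, ‖cutoffTransform P 𝒢 (levelCutoff x c)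
        (massCutoff P 𝒢 (levelCutoff x c) g K) f i ω‖ ≤ c + K := fun i f hf hfg hfx => by
    refine h.norm_transform_le_add hK0 hc0 hgi hf hfg ?_
    have : ∀ᵐ ω ∂P, ∀ j ≤ i, (P[f|𝒢 j]) ω = x j ω :=
      ae_all_iff.2 fun j => eventually_imp_distrib_left.2 fun hj => hfx j hj
    filter_upwards [this] with ω hω j hj
    rw [hω j hj]
    unfold levelCutoff
    split_ifs with h'
    · rw [one_mul]; exact (h' j le_rfl).le
    · rw [zero_mul]; exact hc0
  refine ⟨_, _, h, hbound, fun i f hf hf1 => ?_, fun N => ?_⟩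
  · refine h.norm_transform_le_add hK0 hc0 hgi hf (.of_forall fun ω => (hf1 ω).trans (hg1 ω)) ?_
    have : ∀ᵐ ω ∂P, ∀ j, ‖(P[f|𝒢 j]) ω‖ ≤ 1 := ae_all_iff.2 fun j =>
      ae_bdd_norm_condExp_of_ae_bdd_norm (R := 1) (.of_forall hf1)
    filter_upwards [this] with ω hω j _
    exact (mul_le_one₀ (h.a_le_one j ω) (norm_nonneg _) (hω j)).trans hc1
  · set W := removedMass P 𝒢 (levelCutoff x c) g N with hW
    have hWm : StronglyMeasurable W :=
      Finset.stronglyMeasurable_fun_sum _ fun j _ => continuous_abs.comp_stronglyMeasurable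
        (stronglyMeasurable_condExp.mono (𝒢.le j))
    have hWs : MeasurableSet {ω | K ≤ W ω} :=
      StronglyMeasurable.measurableSet_le stronglyMeasurable_const hWm
    have hgs : MeasurableSet {ω | c ≤ g ω} :=
      StronglyMeasurable.measurableSet_le stronglyMeasurable_const hgm
    have hWp := removedMass_eLpNorm_le (P := P) (c := c) hx hxg hp hgm hg hg0 N
    have hW1 := removedMass_eLpNorm_le (P := P) (c := c) hx hxg le_rfl hgm
      (by simpa using memLp_one_iff_integrable.2 hgi) hg0 N
    rw [← hW] at hWp hW1
    have hm1 : AEStronglyMeasurable ({ω | c ≤ g ω}.indicator g) P :=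
      (hgm.indicator hgs).aestronglyMeasurable
    have hm2 : AEStronglyMeasurable ({ω | K ≤ W ω}.indicator fun ω => g ω + c) P :=
      hgc.aestronglyMeasurable.indicator hWs
    have hPW : P {ω | K ≤ W ω} ≤ ENNReal.ofReal δ := by
      have e1 : ENNReal.ofReal K * P {ω | K ≤ W ω} ≤ I := by
        calc ENNReal.ofReal K * P {ω | K ≤ W ω}
            ≤ ENNReal.ofReal K * P {ω | ENNReal.ofReal K ≤ ‖W ω‖ₑ} := by
              refine mul_le_mul_right (measure_mono fun ω hω => ?_) _
              exact (ENNReal.ofReal_le_ofReal hω).trans (Real.ofReal_le_enorm _)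
          _ ≤ ∫⁻ ω, ‖W ω‖ₑ ∂P := mul_meas_ge_le_lintegral₀ hWm.aestronglyMeasurable.enorm _
          _ ≤ I := by
              rw [← eLpNorm_one_eq_lintegral_enorm]
              simp only [ENNReal.ofReal_one, one_mul] at hW1
              exact hW1.trans (eLpNorm_indicator_le g)
      have e2 : I ≤ ENNReal.ofReal K * ENNReal.ofReal δ := by
        rw [← ENNReal.ofReal_mul hK0, ← ENNReal.ofReal_toReal hI_top]
        refine ENNReal.ofReal_le_ofReal ?_
        rw [← div_le_iff₀ hδ]
        exact le_max_right _ _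
      exact (ENNReal.mul_le_mul_iff_right (by simpa using zero_lt_one.trans_le hK1)
        ENNReal.ofReal_ne_top).1 (e1.trans e2)
    refine ⟨_, (hm1.add hWm.aestronglyMeasurable).add hm2, ?_, fun i hi f hf hfg hfx =>
      norm_sub_cutoffTransform_le hx hxg hgi hg0 hK0 hc0 hi hf hfg hfx (hbound i f hf hfg hfx)⟩
    refine (eLpNorm_add_le (hm1.add hWm.aestronglyMeasurable) hm2 hp1).trans ?_
    refine (add_le_add (eLpNorm_add_le hm1 hWm.aestronglyMeasurable hp1) (hδs _ hWs hPW)).trans ?_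
    have e : ENNReal.ofReal ε = (ENNReal.ofReal (ε / (2 * (1 + p))) +
        ENNReal.ofReal p * ENNReal.ofReal (ε / (2 * (1 + p)))) + ENNReal.ofReal (ε / 2) := by
      rw [← ENNReal.ofReal_mul (by linarith), ← ENNReal.ofReal_add (by positivity) (by positivity),
        ← ENNReal.ofReal_add (by positivity) (by positivity)]
      congr 1
      field_simp
      ring
    rw [e]
    exact add_le_add (add_le_add htail (hWp.trans (mul_le_mul_right htail _))) le_rfl

end CutoffBounds

/-- A version of `exists_limit_convex_combinations` for data depending on countably many bounded
coordinates. -/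
theorem exists_limit_convex_combinations_of_coordinates {G Y I ι : Type*} [NormedAddCommGroup G]
    [InnerProductSpace ℝ G] [CompleteSpace G] [NormedAddCommGroup Y] [NormedSpace ℝ Y]
    [CompleteSpace Y] [SemilatticeSup I] [Nonempty I] [Countable ι] {v : I → ι → G} {R : ℝ}
    (hv : ∀ D k, ‖v D k‖ ≤ R) {Φ : ℕ → I → Y}
    (hΦ : ∀ n, ∀ δ > 0, ∃ (s : Finset ι) (A : ι → G →L[ℝ] Y),
      ∀ D, ‖Φ n D - ∑ k ∈ s, A k (v D k)‖ ≤ δ) :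
    ∃ y : ℕ → Y, ∀ (D : I) (N : ℕ), ∀ δ > 0, ∃ (κ : Type) (_ : Fintype κ) (w : κ → ℝ) (d : κ → I),
      (∀ i, D ≤ d i) ∧ (∀ i, 0 ≤ w i) ∧ ∑ i, w i = 1 ∧
        ∀ n ≤ N, ‖∑ i, w i • Φ n (d i) - y n‖ ≤ δ := by
  have := Encodable.ofCountable ι
  let c : ι → ℝ := fun k => (1 / 2) ^ Encodable.encode k
  have hc0 : ∀ k, 0 < c k := fun k => by positivity
  have hc1 : ∀ k, c k ≤ 1 := fun k => pow_le_one₀ (by norm_num) (by norm_num)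
  have hsum : ∀ (D : I) (s : Finset ι),
      ∑ k ∈ s, ‖c k • v D k‖ ^ (2 : ℝ≥0∞).toReal ≤ (∑' k, c k) * R ^ 2 := fun D s => by
    calc ∑ k ∈ s, ‖c k • v D k‖ ^ (2 : ℝ≥0∞).toReal ≤ ∑ k ∈ s, c k * R ^ 2 := by
          refine Finset.sum_le_sum fun k _ => ?_
          rw [ENNReal.toReal_ofNat, Real.rpow_ofNat, norm_smul, mul_pow,
            Real.norm_of_nonneg (hc0 k).le]
          refine mul_le_mul ?_ (pow_le_pow_left₀ (norm_nonneg _) (hv D k) 2) (by positivity)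
            (hc0 k).le
          exact pow_le_of_le_one (hc0 k).le (hc1 k) two_ne_zero
      _ = (∑ k ∈ s, c k) * R ^ 2 := (Finset.sum_mul ..).symm
      _ ≤ _ := mul_le_mul_of_nonneg_right
          (summable_geometric_two_encode.sum_le_tsum s fun k _ => (hc0 k).le) (sq_nonneg R)
  let u : I → lp (fun _ : ι => G) 2 := fun D => ⟨fun k => c k • v D k, memℓp_gen' (hsum D)⟩
  have hS0 : 0 ≤ (∑' k, c k) * R ^ 2 := mul_nonneg (tsum_nonneg fun k => (hc0 k).le) (sq_nonneg R)
  refine exists_limit_convex_combinations (u := u) (R := √((∑' k, c k) * R ^ 2)) (fun D => ?_)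
    fun n δ hδ => ?_
  · refine lp.norm_le_of_forall_sum_le (by norm_num) (Real.sqrt_nonneg _) fun s => ?_
    refine (hsum D s).trans_eq ?_
    rw [ENNReal.toReal_ofNat, Real.rpow_ofNat, Real.sq_sqrt hS0]
  · obtain ⟨s, A, hA⟩ := hΦ n δ hδ
    refine ⟨∑ k ∈ s, (A k).comp ((c k)⁻¹ • lp.evalCLM ℝ (fun _ : ι => G) 2 k), fun D => ?_⟩
    convert hA D using 3
    rw [sum_apply]
    refine Finset.sum_congr rfl fun k _ => ?_
    simp only [ContinuousLinearMap.comp_apply, smul_apply]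
    congr 1
    change (c k)⁻¹ • c k • v D k = v D k
    rw [inv_smul_smul₀ (hc0 k).ne']

lemma exists_smulRight_L2_L1 {Ω E : Type*} {m : MeasurableSpace Ω} (P : Measure Ω)
    [IsProbabilityMeasure P] [NormedAddCommGroup E] [NormedSpace ℝ E] (x : E) :
    ∃ B : Lp ℝ 2 P →L[ℝ] Lp E 1 P, ∀ v : Lp ℝ 2 P, B v =ᵐ[P] fun ω => v ω • x := by
  have hmem : ∀ v : Lp ℝ 2 P, MemLp (fun ω => v ω • x) 1 P := fun v =>
    memLp_one_iff_integrable.2 (((Lp.memLp v).integrable (by norm_num)).smul_const x)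
  refine ⟨LinearMap.mkContinuous
    { toFun := fun v => (hmem v).toLp _
      map_add' := fun v w => ?_
      map_smul' := fun r v => ?_ } ‖x‖ fun v => ?_, fun v => (hmem v).coeFn_toLp⟩
  · rw [← MemLp.toLp_add]
    refine (MemLp.toLp_eq_toLp_iff _ _).2 ?_
    filter_upwards [Lp.coeFn_add v w] with ω hω
    rw [hω, Pi.add_apply, add_smul, Pi.add_apply]
  · rw [RingHom.id_apply, ← MemLp.toLp_const_smul]
    refine (MemLp.toLp_eq_toLp_iff _ _).2 ?_
    filter_upwards [Lp.coeFn_smul r v] with ω hω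
    simp [hω, smul_smul]
  · change ‖(hmem v).toLp _‖ ≤ _
    rw [Lp.norm_toLp, Lp.norm_def, ← toReal_enorm x, ← ENNReal.toReal_mul]
    refine ENNReal.toReal_mono (ENNReal.mul_ne_top (by simp) (Lp.eLpNorm_ne_top v)) ?_
    calc eLpNorm (fun ω => v ω • x) 1 P ≤ eLpNorm (‖x‖ • ⇑v) 1 P :=
          eLpNorm_mono fun ω => by simp [norm_smul, mul_comm]
      _ = ‖x‖ₑ * eLpNorm v 1 P := by rw [eLpNorm_const_smul, enorm_norm]
      _ ≤ _ := mul_le_mul_right (eLpNorm_le_eLpNorm_of_exponent_le (by norm_num)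
          (Lp.aestronglyMeasurable v)) _

section LimitMartingale

variable {Ω X : Type*} {m : MeasurableSpace Ω} {P : Measure Ω} [IsProbabilityMeasure P]
  [NormedAddCommGroup X] [NormedSpace ℝ X] [CompleteSpace X]

/-- Cutoff transforms whose action on indicators is uniformly bounded have convergent convex
combinations. -/
theorem exists_limit_cutoffTransform {I : Type*} [SemilatticeSup I] [Nonempty I] {R : ℝ}
    {𝒢 : I → Filtration ℕ m} {a b : I → ℕ → Ω → ℝ} (h : ∀ D, Cutoff (𝒢 D) (a D) (b D))
    (hR : ∀ D i (φ : Ω → ℝ), Integrable φ P → (∀ ω, |φ ω| ≤ 1) →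
      ∀ᵐ ω ∂P, |cutoffTransform P (𝒢 D) (a D) (b D) φ i ω| ≤ R)
    (idx : I → ℕ → ℕ) {f : ℕ → Ω → X} (hf : ∀ n, Integrable (f n) P) :
    ∃ y : ℕ → Lp X 1 P, ∀ (D : I) (N : ℕ), ∀ δ > 0,
      ∃ (κ : Type) (_ : Fintype κ) (w : κ → ℝ) (d : κ → I),
        (∀ i, D ≤ d i) ∧ (∀ i, 0 ≤ w i) ∧ ∑ i, w i = 1 ∧ ∀ n ≤ N,
        eLpNorm (fun ω => ∑ i, w i • cutoffTransform P (𝒢 (d i)) (a (d i)) (b (d i)) (f n)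
          (idx (d i) n) ω - y n ω) 1 P ≤ ENNReal.ofReal δ := by
  have happ : ∀ q : ℕ × ℕ, ∃ s : SimpleFunc Ω X,
      eLpNorm (f q.1 - ⇑s) 1 P < ENNReal.ofReal (1 / (q.2 + 1)) := fun q => by
    obtain ⟨s, hs, -⟩ := (memLp_one_iff_integrable.2 (hf q.1)).exists_simpleFunc_eLpNorm_sub_lt
      ENNReal.one_ne_top (ε := ENNReal.ofReal (1 / (q.2 + 1)))
      (ENNReal.ofReal_pos.2 Nat.one_div_pos_of_nat).ne'
    exact ⟨s, hs⟩
  choose s hs using happ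
  let ι := Σ q : ℕ × ℕ, (s q).range
  let S : ι → Set Ω := fun k => s k.1 ⁻¹' {k.2.1}
  have hSi : ∀ k, Integrable ((S k).indicator (1 : Ω → ℝ)) P := fun k =>
    (integrable_const 1).indicator ((s k.1).measurableSet_fiber _)
  have hSR : ∀ D k, ∀ᵐ ω ∂P, ‖cutoffTransform P (𝒢 D) (a D) (b D) ((S k).indicator (1 : Ω → ℝ))
      (idx D k.1.1) ω‖ ≤ R := fun D k => hR D _ _ (hSi k) fun ω => by
    by_cases hω : ω ∈ S k <;> simp [hω]
  have hmem : ∀ D k, MemLp (cutoffTransform P (𝒢 D) (a D) (b D) ((S k).indicator (1 : Ω → ℝ))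
      (idx D k.1.1)) 2 P := fun D k =>
    MemLp.of_bound ((h D).integrable_transform _).aestronglyMeasurable R (hSR D k)
  let v : I → ι → Lp ℝ 2 P := fun D k => (hmem D k).toLp _
  have hΦm : ∀ n D, MemLp (cutoffTransform P (𝒢 D) (a D) (b D) (f n) (idx D n)) 1 P := fun n D =>
    memLp_one_iff_integrable.2 ((h D).integrable_transform _)
  let Φ : ℕ → I → Lp X 1 P := fun n D => (hΦm n D).toLp _
  choose B hB using fun x : X => exists_smulRight_L2_L1 P x
  have hv : ∀ D k, ‖v D k‖ ≤ max R 0 := fun D k => by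
    have h1 := Lp.norm_le_of_ae_bound (f := v D k) (C := max R 0) (le_max_right _ _) (by
      filter_upwards [(hmem D k).coeFn_toLp, hSR D k] with ω h1 h2
      rw [h1]
      exact h2.trans (le_max_left _ _))
    have hu : measureUnivNNReal P = 1 := by simp [measureUnivNNReal]
    simpa only [hu, NNReal.coe_one, Real.one_rpow, one_mul] using h1
  obtain ⟨y, hy⟩ := exists_limit_convex_combinations_of_coordinates hv (Φ := Φ)
    fun n δ hδ => by
      obtain ⟨j, hj⟩ := exists_nat_one_div_lt hδ
      refine ⟨(s (n, j)).range.attach.map ⟨fun x => ⟨(n, j), x⟩,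
        fun _ _ hxy => eq_of_heq (Sigma.mk.inj hxy).2⟩,
        fun k => B k.2.1, fun D => ?_⟩
      rw [Finset.sum_map]
      change ‖Φ n D - ∑ x ∈ (s (n, j)).range.attach, B x.1 (v D ⟨(n, j), x⟩)‖ ≤ δ
      rw [← ENNReal.ofReal_le_ofReal_iff hδ.le, ofReal_norm, Lp.enorm_def]
      refine le_trans ?_ ((hs (n, j)).le.trans (ENNReal.ofReal_le_ofReal hj.le))
      refine le_trans (eLpNorm_congr_ae ?_).le ((h D).eLpNorm_transform_sub_le (hf n)
        ((s (n, j)).integrable_of_isFiniteMeasure) (idx D n))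
      have e1 : ∀ᵐ ω ∂P, ∀ x : (s (n, j)).range, (B x.1 (v D ⟨(n, j), x⟩)) ω =
          cutoffTransform P (𝒢 D) (a D) (b D) ((s (n, j) ⁻¹' {x.1}).indicator (1 : Ω → ℝ))
            (idx D n) ω • x.1 := by
        refine ae_all_iff.2 fun x => ?_
        filter_upwards [hB x.1 (v D ⟨(n, j), x⟩), (hmem D ⟨(n, j), x⟩).coeFn_toLp] with ω h1 h2
        rw [h1]
        rw [show (v D ⟨(n, j), x⟩) ω = _ from h2]
      filter_upwards [e1, Lp.coeFn_sub (Φ n D)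
        (∑ x ∈ (s (n, j)).range.attach, B x.1 (v D ⟨(n, j), x⟩)), (hΦm n D).coeFn_toLp,
        Lp.coeFn_finsetSum (s (n, j)).range.attach fun x => B x.1 (v D ⟨(n, j), x⟩),
        (h D).transform_simpleFunc (s (n, j)) (idx D n)] with ω h1 h2 h3 h4 h5
      rw [h2, Pi.sub_apply, Pi.sub_apply, h4, h5, Finset.sum_apply,
        ← Finset.sum_attach (s (n, j)).range]
      congr 1
      exact Finset.sum_congr rfl fun x _ => h1 x
  refine ⟨y, fun D N δ hδ => ?_⟩
  obtain ⟨κ, hκ, w, d, hd, hw0, hw1, hw⟩ := hy D N δ hδ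
  refine ⟨κ, hκ, w, d, hd, hw0, hw1, fun n hn => ?_⟩
  have h1 := ENNReal.ofReal_le_ofReal (hw n hn)
  rw [ofReal_norm, Lp.enorm_def] at h1
  refine (eLpNorm_congr_ae ?_).trans_le h1
  have e1 : ∀ᵐ ω ∂P, ∀ i, (w i • Φ n (d i)) ω = w i • cutoffTransform P (𝒢 (d i)) (a (d i))
      (b (d i)) (f n) (idx (d i) n) ω := ae_all_iff.2 fun i => by
    filter_upwards [Lp.coeFn_smul (w i) (Φ n (d i)), (hΦm n (d i)).coeFn_toLp] with ω h1 h2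
    rw [h1, Pi.smul_apply]
    exact congrArg (w i • ·) h2
  filter_upwards [e1, Lp.coeFn_sub (∑ i, w i • Φ n (d i)) (y n),
    Lp.coeFn_finsetSum Finset.univ fun i => w i • Φ n (d i)] with ω h1 h2 h3
  rw [h2, Pi.sub_apply, h3, Finset.sum_apply]
  simp only [h1]

end LimitMartingale

section FiniteTimes

variable {Ω E : Type*} {m : MeasurableSpace Ω} {P : Measure Ω} [IsProbabilityMeasure P]
  [NormedAddCommGroup E] [NormedSpace ℝ E] [CompleteSpace E]

lemma exists_monotone_enumeration {α : Type*} [LinearOrder α] [Nonempty α] (D : Finset α) :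
    ∃ (s : ℕ → α) (idx : α → ℕ), Monotone s ∧ ∀ t ∈ D, s (idx t) = t := by
  rcases D.eq_empty_or_nonempty with rfl | hD
  · exact ⟨fun _ => Classical.arbitrary α, fun _ => 0, monotone_const, by simp⟩
  have hc : 0 < D.card := hD.card_pos
  let s : ℕ → α := fun i => D.orderEmbOfFin rfl ⟨min i (D.card - 1), by omega⟩
  have hs : ∀ t, ∃ i, t ∈ D → s i = t := fun t => by
    by_cases ht : t ∈ D
    · obtain ⟨i, hi⟩ : t ∈ Set.range (D.orderEmbOfFin rfl) := by simpa using ht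
      refine ⟨i, fun _ => ?_⟩
      rw [← hi]
      exact congrArg _ (Fin.ext (min_eq_left (by omega)))
    · exact ⟨0, fun h => absurd h ht⟩
  choose idx hidx using hs
  exact ⟨s, idx, fun i j hij => (D.orderEmbOfFin rfl).monotone
    (Fin.mk_le_mk.2 (min_le_min_right _ hij)), hidx⟩

/-- Cutoffs of a martingale indexed by a linear order along the elements of a finite set `D`. -/
theorem exists_cutoff_of_finset {τ : Type*} [LinearOrder τ] [Nonempty τ] {ℱ : Filtration τ m}
    {M : τ → Ω → E} (hM : Martingale M ℱ P) {p : ℝ} (hp : 1 ≤ p) {g : Ω → ℝ}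
    (hgm : StronglyMeasurable g) (hg1 : ∀ ω, 1 ≤ g ω) (hg : MemLp g (ENNReal.ofReal p) P)
    (hMg : ∀ t, ∀ᵐ ω ∂P, ‖M t ω‖ ≤ g ω) {ε : ℝ} (hε : 0 < ε) :
    ∃ R : ℝ, ∀ D : Finset τ, ∃ (𝒢 : Filtration ℕ m) (a b : ℕ → Ω → ℝ) (idx : τ → ℕ),
      Cutoff 𝒢 a b ∧
      (∀ i (φ : Ω → ℝ), Integrable φ P → (∀ ω, |φ ω| ≤ 1) →
        ∀ᵐ ω ∂P, |cutoffTransform P 𝒢 a b φ i ω| ≤ R) ∧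
      (∀ t ∈ D, ∀ᵐ ω ∂P, ‖cutoffTransform P 𝒢 a b (M t) (idx t) ω‖ ≤ R) ∧
      (∀ t ∈ D, ∀ u ∈ D, t ≤ u → P[cutoffTransform P 𝒢 a b (M u) (idx u)|ℱ t] =ᵐ[P]
        cutoffTransform P 𝒢 a b (M t) (idx t)) ∧
      ∃ Y : Ω → ℝ, AEStronglyMeasurable Y P ∧ eLpNorm Y (ENNReal.ofReal p) P ≤ ENNReal.ofReal ε ∧
        ∀ t ∈ D, ∀ᵐ ω ∂P, ‖M t ω - cutoffTransform P 𝒢 a b (M t) (idx t) ω‖ ≤ Y ω := by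
  obtain ⟨R, hR⟩ := exists_cutoff E hp hgm hg1 hg hε
  refine ⟨R, fun D => ?_⟩
  obtain ⟨s, idx, hs, hidx⟩ := exists_monotone_enumeration D
  let 𝒢 : Filtration ℕ m := ⟨fun i => ℱ (s i), fun i j hij => ℱ.mono (hs hij), fun i => ℱ.le _⟩
  have h𝒢 : ∀ t ∈ D, 𝒢 (idx t) = ℱ t := fun t ht => by
    change ℱ (s (idx t)) = ℱ t
    rw [hidx t ht]
  obtain ⟨a, b, h, h1, h2, h3⟩ := hR 𝒢 (fun j => M (s j)) (fun j => hM.1 (s j))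
    fun j => hMg (s j)
  have hcond : ∀ t ∈ D, ∀ j ≤ idx t, P[M t|𝒢 j] =ᵐ[P] M (s j) := fun t ht j hj =>
    hM.condExp_ae_eq ((hs hj).trans_eq (hidx t ht))
  refine ⟨𝒢, a, b, idx, h, h2, fun t ht => h1 _ _ (hM.integrable t) (hMg t) (hcond t ht),
    fun t ht u hu htu => ?_, ?_⟩
  · have e1 : cutoffTransform P 𝒢 a b (M t) (idx t) =ᵐ[P]
        cutoffTransform P 𝒢 a b (M u) (idx t) := by
      refine EventuallyEq.trans ?_ (h.transform_condExp (hM.integrable u) (idx t))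
      refine cutoffTransform_congr_ae _ ?_
      rw [h𝒢 t ht]
      exact (hM.condExp_ae_eq htu).symm
    refine EventuallyEq.trans ?_ e1.symm
    rcases htu.eq_or_lt with rfl | htu
    · rw [← h𝒢 t ht]
      exact (h.martingale_transform (hM.integrable t)).condExp_ae_eq le_rfl
    · rw [← h𝒢 t ht]
      refine (h.martingale_transform (hM.integrable u)).condExp_ae_eq ?_
      by_contra! hlt
      have := hs hlt.le
      rw [hidx t ht, hidx u hu] at this
      exact this.not_gt htu
  · obtain ⟨Y, hYm, hY, hYM⟩ := h3 (D.sup idx)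
    refine ⟨Y, hYm, hY, fun t ht => ?_⟩
    have := hYM (idx t) (Finset.le_sup ht) (M t) (hM.integrable t) (hMg t) (hcond t ht)
    rwa [hidx t ht] at this

end FiniteTimes

section Limit

lemma lintegral_rpow_le_of_forall_le_add {Ω : Type*} {m : MeasurableSpace Ω} {P : Measure Ω}
    {Z : Ω → ℝ≥0∞} (hZ : AEMeasurable Z P) {p : ℝ} (hp : 0 ≤ p) {c : ℝ≥0∞}
    (h : ∀ δ : ℝ, 0 < δ → ∃ Y V : Ω → ℝ≥0∞, AEMeasurable V P ∧ (∀ᵐ ω ∂P, Z ω ≤ Y ω + V ω) ∧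
      ∫⁻ ω, Y ω ^ p ∂P ≤ c ∧ ∫⁻ ω, V ω ∂P ≤ ENNReal.ofReal δ) :
    ∫⁻ ω, Z ω ^ p ∂P ≤ c := by
  choose Y V hVm hZV hY hV using fun k : ℕ => h ((1 / 2) ^ k) (by positivity)
  have hsum : ∀ᵐ ω ∂P, ∑' k, V k ω < ⊤ := by
    refine ae_lt_top' (AEMeasurable.tsum hVm) (ne_of_lt ?_)
    rw [lintegral_tsum hVm]
    refine (ENNReal.tsum_le_tsum hV).trans_lt ?_
    exact summable_geometric_two.tsum_ofReal_lt_top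
  have hlim : ∀ᵐ ω ∂P, Z ω ^ p ≤ liminf (fun k => (Z ω - V k ω) ^ p) atTop := by
    filter_upwards [hsum] with ω hω
    have h0 := ENNReal.tendsto_atTop_zero_of_tsum_ne_top hω.ne
    have h1 : Tendsto (fun k => Z ω - V k ω) atTop (𝓝 (Z ω - 0)) :=
      ENNReal.Tendsto.sub tendsto_const_nhds h0 (Or.inr ENNReal.zero_ne_top)
    rw [tsub_zero] at h1
    exact (((ENNReal.continuous_rpow_const (y := p)).tendsto _).comp h1).liminf_eq.ge
  calc ∫⁻ ω, Z ω ^ p ∂P ≤ ∫⁻ ω, liminf (fun k => (Z ω - V k ω) ^ p) atTop ∂P :=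
        lintegral_mono_ae hlim
    _ ≤ liminf (fun k => ∫⁻ ω, (Z ω - V k ω) ^ p ∂P) atTop :=
        lintegral_liminf_le' fun k => (hZ.sub (hVm k)).pow_const p
    _ ≤ liminf (fun _ : ℕ => c) atTop := by
        refine liminf_le_liminf (Eventually.of_forall fun k => ?_)
        refine (lintegral_mono_ae ?_).trans (hY k)
        filter_upwards [hZV k] with ω hω
        exact ENNReal.rpow_le_rpow (tsub_le_iff_right.2 hω) hp
    _ = c := liminf_const c

lemma ae_le_of_forall_le_add {Ω : Type*} {m : MeasurableSpace Ω} {P : Measure Ω}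
    {Z : Ω → ℝ≥0∞} (hZ : AEMeasurable Z P) {c : ℝ≥0∞}
    (h : ∀ δ : ℝ, 0 < δ → ∃ V : Ω → ℝ≥0∞, (∀ᵐ ω ∂P, Z ω ≤ c + V ω) ∧
      ∫⁻ ω, V ω ∂P ≤ ENNReal.ofReal δ) :
    ∀ᵐ ω ∂P, Z ω ≤ c := by
  have h0 : ∫⁻ ω, (Z ω - c) ∂P = 0 := by
    refine le_antisymm (ENNReal.le_of_forall_pos_le_add fun δ hδ _ => ?_) zero_le
    obtain ⟨V, hV, hVδ⟩ := h δ hδ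
    rw [ENNReal.ofReal_coe_nnreal] at hVδ
    rw [zero_add]
    refine (lintegral_mono_ae ?_).trans hVδ
    filter_upwards [hV] with ω hω
    exact tsub_le_iff_left.2 hω
  filter_upwards [(lintegral_eq_zero_iff' (hZ.sub aemeasurable_const)).1 h0] with ω hω
  exact tsub_eq_zero_iff_le.1 hω

variable {Ω X : Type*} {m : MeasurableSpace Ω} {P : Measure Ω} [IsProbabilityMeasure P]
  [NormedAddCommGroup X] [NormedSpace ℝ X] [CompleteSpace X]

/-- A martingale dominated by a function in `L^p` is close, uniformly on finite sets of times, to a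
bounded martingale. -/
theorem exists_bounded_martingale_close {ℱ : Filtration ℝ≥0 m} {M : ℝ≥0 → Ω → X}
    (hM : Martingale M ℱ P) {p : ℝ} (hp : 1 ≤ p) {g : Ω → ℝ}
    (hgm : StronglyMeasurable g) (hg1 : ∀ ω, 1 ≤ g ω) (hg : MemLp g (ENNReal.ofReal p) P)
    (hMg : ∀ t, ∀ᵐ ω ∂P, ‖M t ω‖ ≤ g ω) {ε : ℝ} (hε : 0 < ε) :
    ∃ (R : ℝ) (M' : ℝ≥0 → Ω → X), Martingale M' ℱ P ∧ (∀ t, ∀ᵐ ω ∂P, ‖M' t ω‖ ≤ R) ∧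
      ∀ S : Finset ℝ≥0, ∫⁻ ω, (⨆ t ∈ S, ‖M t ω - M' t ω‖ₑ) ^ p ∂P ≤ ENNReal.ofReal ε ^ p := by
  obtain ⟨R, hR⟩ := exists_cutoff_of_finset hM hp hgm hg1 hg hMg hε
  choose 𝒢 a b idx h hφ hN hcond Y hYm hY hYM using hR
  obtain ⟨y, hy⟩ := exists_limit_cutoffTransform h hφ (fun D n => idx D n)
    fun n : ℕ => hM.integrable n
  have hyi : ∀ n, Integrable (y n) P := fun n => L1.integrable_coeFn _
  let M' : ℝ≥0 → Ω → X := fun t => P[y ⌈t⌉₊|ℱ t]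
  have hM'i : ∀ t, Integrable (M' t) P := fun t => integrable_condExp
  have key : ∀ (S : Finset ℝ≥0), ∀ δ > 0, ∃ (V : ℝ≥0 → Ω → X) (W : Ω → ℝ),
      (∀ t, Integrable (V t) P) ∧
      (∀ t ∈ S, eLpNorm (V t - M' t) 1 P ≤ ENNReal.ofReal δ) ∧
      (∀ t ∈ S, ∀ᵐ ω ∂P, ‖V t ω‖ ≤ R) ∧
      (∀ t ∈ S, ∀ u ∈ S, t ≤ u → P[V u|ℱ t] =ᵐ[P] V t) ∧
      eLpNorm W (ENNReal.ofReal p) P ≤ ENNReal.ofReal ε ∧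
      ∀ t ∈ S, ∀ᵐ ω ∂P, ‖M t ω - V t ω‖ ≤ W ω := by
    intro S δ hδ
    obtain ⟨κ, _, w, d, hd, hw0, hw1, hw⟩ := hy (S ∪ S.image fun t => (⌈t⌉₊ : ℝ≥0))
      (S.sup fun t => ⌈t⌉₊) δ hδ
    let N : κ → ℝ≥0 → Ω → X := fun i t =>
      cutoffTransform P (𝒢 (d i)) (a (d i)) (b (d i)) (M t) (idx (d i) t)
    have hNi : ∀ i t, Integrable (N i t) P := fun i t => (h (d i)).integrable_transform _
    have hS : ∀ t ∈ S, ∀ i, t ∈ d i := fun t ht i => hd i (Finset.mem_union_left _ ht)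
    have hS' : ∀ t ∈ S, ∀ i, (⌈t⌉₊ : ℝ≥0) ∈ d i := fun t ht i =>
      hd i (Finset.mem_union_right _ (Finset.mem_image_of_mem _ ht))
    have hVi : ∀ t, Integrable (∑ i, w i • N i t) P := fun t =>
      integrable_finsetSum' _ fun i _ => (hNi i t).smul (w i)
    have hVc : ∀ t u, (∀ i, t ∈ d i) → (∀ i, u ∈ d i) → t ≤ u →
        P[∑ i, w i • N i u|ℱ t] =ᵐ[P] ∑ i, w i • N i t := fun t u ht hu htu => by
      refine (condExp_finsetSum (fun i _ => (hNi i u).smul (w i)) _).trans ?_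
      have e1 : ∀ᵐ ω ∂P, ∀ i, (P[w i • N i u|ℱ t]) ω = w i • N i t ω := ae_all_iff.2 fun i => by
        filter_upwards [condExp_smul (w i) (N i u) (ℱ t), hcond (d i) t (ht i) u (hu i) htu]
          with ω h1 h2
        rw [h1, Pi.smul_apply, h2]
      filter_upwards [e1] with ω h1
      simp only [Finset.sum_apply, h1, Pi.smul_apply]
    refine ⟨fun t => ∑ i, w i • N i t, ∑ i, w i • Y (d i), hVi, fun t ht => ?_, fun t ht => ?_,
      fun t ht u hu htu => hVc t u (hS t ht) (hS u hu) htu, ?_, fun t ht => ?_⟩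
    · have e1 : (∑ i, w i • N i t) - M' t =ᵐ[P] P[(∑ i, w i • N i ⌈t⌉₊) - y ⌈t⌉₊|ℱ t] := by
        refine EventuallyEq.trans ?_ (condExp_sub (hVi _) (hyi _) _).symm
        exact (hVc t ⌈t⌉₊ (hS t ht) (hS' t ht) (Nat.le_ceil t)).symm.sub EventuallyEq.rfl
      rw [eLpNorm_congr_ae e1]
      refine (eLpNorm_condExp_le_eLpNorm _ le_rfl).trans ?_
      refine le_trans (eLpNorm_congr_ae (Eventually.of_forall fun ω => ?_)).le
        (hw ⌈t⌉₊ (Finset.le_sup (f := fun t : ℝ≥0 => ⌈t⌉₊) ht))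
      simp only [Pi.sub_apply, Finset.sum_apply, Pi.smul_apply, N]
    · have e1 : ∀ᵐ ω ∂P, ∀ i, ‖N i t ω‖ ≤ R := ae_all_iff.2 fun i => hN (d i) t (hS t ht i)
      filter_upwards [e1] with ω hω
      rw [Finset.sum_apply]
      calc ‖∑ i, (w i • N i t) ω‖ ≤ ∑ i, w i * R := norm_sum_le_of_le _ fun i _ => by
            rw [Pi.smul_apply, norm_smul, Real.norm_of_nonneg (hw0 i)]
            exact mul_le_mul_of_nonneg_left (hω i) (hw0 i)
        _ = R := by rw [← Finset.sum_mul, hw1, one_mul]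
    · calc eLpNorm (∑ i, w i • Y (d i)) (ENNReal.ofReal p) P
          ≤ ∑ i, eLpNorm (w i • Y (d i)) (ENNReal.ofReal p) P :=
            eLpNorm_sum_le (fun i _ => (hYm (d i)).const_smul _) (by simpa using hp)
        _ ≤ ∑ i, ENNReal.ofReal (w i) * ENNReal.ofReal ε := Finset.sum_le_sum fun i _ => by
            rw [eLpNorm_const_smul, Real.enorm_of_nonneg (hw0 i)]
            exact mul_le_mul_right (hY (d i)) _
        _ = ENNReal.ofReal ε := by
            rw [← Finset.sum_mul, ← ENNReal.ofReal_sum_of_nonneg fun i _ => hw0 i, hw1,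
              ENNReal.ofReal_one, one_mul]
    · have e1 : ∀ᵐ ω ∂P, ∀ i, ‖M t ω - N i t ω‖ ≤ Y (d i) ω :=
        ae_all_iff.2 fun i => hYM (d i) t (hS t ht i)
      filter_upwards [e1] with ω hω
      have e2 : M t ω - (∑ i, w i • N i t) ω = ∑ i, w i • (M t ω - N i t ω) := by
        simp only [smul_sub, Finset.sum_sub_distrib, ← Finset.sum_smul, hw1, one_smul,
          Finset.sum_apply, Pi.smul_apply]
      rw [e2, Finset.sum_apply]
      refine norm_sum_le_of_le _ fun i _ => ?_
      rw [Pi.smul_apply, norm_smul, Real.norm_of_nonneg (hw0 i), smul_eq_mul]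
      exact mul_le_mul_of_nonneg_left (hω i) (hw0 i)
  have hM'm : ∀ t, StronglyMeasurable (M' t) := fun t =>
    stronglyMeasurable_condExp.mono (ℱ.le t)
  have hMm : ∀ t, StronglyMeasurable (M t) := fun t => (hM.1 t).mono (ℱ.le t)
  refine ⟨max R 0, M', ⟨fun t => stronglyMeasurable_condExp, fun t u htu => ?_⟩,
    fun t => ?_, fun S => ?_⟩
  · have h0 : eLpNorm (P[M' u|ℱ t] - M' t) 1 P = 0 := by
      refine le_antisymm (ENNReal.le_of_forall_pos_le_add fun δ hδ _ => ?_) zero_le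
      obtain ⟨V, W, hVi, hV, -, hVc, -, -⟩ := key {t, u} (δ / 2) (by positivity)
      have e1 : P[M' u|ℱ t] - M' t =ᵐ[P] P[M' u - V u|ℱ t] + (V t - M' t) := by
        filter_upwards [condExp_sub (hM'i u) (hVi u) (ℱ t), hVc t (by simp) u (by simp) htu]
          with ω h1 h2
        simp only [Pi.add_apply, Pi.sub_apply, h1, h2]
        abel
      calc eLpNorm (P[M' u|ℱ t] - M' t) 1 P
          ≤ eLpNorm (P[M' u - V u|ℱ t]) 1 P + eLpNorm (V t - M' t) 1 P := by
            rw [eLpNorm_congr_ae e1]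
            exact eLpNorm_add_le integrable_condExp.aestronglyMeasurable
              ((hVi t).sub (hM'i t)).aestronglyMeasurable le_rfl
        _ ≤ ENNReal.ofReal (δ / 2) + ENNReal.ofReal (δ / 2) := by
            refine add_le_add ((eLpNorm_condExp_le_eLpNorm _ le_rfl).trans ?_) (hV t (by simp))
            rw [eLpNorm_sub_comm]
            exact hV u (by simp)
        _ = 0 + δ := by
            rw [← ENNReal.ofReal_add (by positivity) (by positivity), add_halves, zero_add,
              ENNReal.ofReal_coe_nnreal]
    rw [eLpNorm_eq_zero_iff (integrable_condExp.sub (hM'i t)).aestronglyMeasurable one_ne_zero]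
      at h0
    filter_upwards [h0] with ω hω
    exact sub_eq_zero.1 hω
  · have hR' : ∀ᵐ ω ∂P, ‖M' t ω‖ₑ ≤ ENNReal.ofReal (max R 0) := by
      refine ae_le_of_forall_le_add (hM'm t).enorm.aemeasurable fun δ hδ => ?_
      obtain ⟨V, W, -, hV, hVR, -, -, -⟩ := key {t} δ hδ
      refine ⟨fun ω => ‖(V t - M' t) ω‖ₑ, ?_, ?_⟩
      · filter_upwards [hVR t (by simp)] with ω hω
        calc ‖M' t ω‖ₑ = ‖V t ω - (V t - M' t) ω‖ₑ := by simp
          _ ≤ ‖V t ω‖ₑ + ‖(V t - M' t) ω‖ₑ := enorm_sub_le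
          _ ≤ _ := by
            rw [← ofReal_norm (V t ω)]
            gcongr
            exact hω.trans (le_max_left _ _)
      · rw [← eLpNorm_one_eq_lintegral_enorm]
        exact hV t (by simp)
    filter_upwards [hR'] with ω hω
    rwa [← ofReal_norm, ENNReal.ofReal_le_ofReal_iff (le_max_right _ _)] at hω
  · have hp0 : 0 < p := zero_lt_one.trans_le hp
    refine lintegral_rpow_le_of_forall_le_add (Measurable.aemeasurable ?_) hp0.le fun δ hδ => ?_
    · exact Measurable.biSup (S : Set ℝ≥0) S.countable_toSet fun t _ =>
        ((hMm t).sub (hM'm t)).enorm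
    obtain ⟨V, W, hVi, hV, -, -, hW, hMW⟩ := key S (δ / (S.card + 1)) (by positivity)
    refine ⟨fun ω => ‖W ω‖ₑ, fun ω => ∑ t ∈ S, ‖(V t - M' t) ω‖ₑ,
      Finset.aemeasurable_fun_sum _ fun t _ =>
        ((hVi t).sub (hM'i t)).aestronglyMeasurable.enorm, ?_, ?_, ?_⟩
    · filter_upwards [(ae_ball_iff S.countable_toSet).2 hMW] with ω hω
      refine iSup₂_le fun t ht => ?_
      calc ‖M t ω - M' t ω‖ₑ = ‖(M t ω - V t ω) + (V t - M' t) ω‖ₑ := by simp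
        _ ≤ ‖M t ω - V t ω‖ₑ + ‖(V t - M' t) ω‖ₑ := enorm_add_le _ _
        _ ≤ _ := by
          refine add_le_add ?_ (Finset.single_le_sum
            (f := fun t => ‖(V t - M' t) ω‖ₑ) (fun _ _ => zero_le) ht)
          rw [← ofReal_norm, ← ofReal_norm]
          exact ENNReal.ofReal_le_ofReal ((hω t ht).trans (le_abs_self _))
    · rw [eLpNorm_eq_lintegral_rpow_enorm_toReal (by simpa using hp0) ENNReal.ofReal_ne_top,
        ENNReal.toReal_ofReal hp0.le, one_div, ENNReal.rpow_inv_le_iff hp0] at hW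
      exact hW
    · rw [lintegral_finsetSum' _ fun t _ =>
        ((hVi t).sub (hM'i t)).aestronglyMeasurable.enorm]
      calc ∑ t ∈ S, ∫⁻ ω, ‖(V t - M' t) ω‖ₑ ∂P
          ≤ ∑ t ∈ S, ENNReal.ofReal (δ / (S.card + 1)) := Finset.sum_le_sum fun t ht => by
            rw [← eLpNorm_one_eq_lintegral_enorm]
            exact hV t ht
        _ = ENNReal.ofReal (S.card * (δ / (S.card + 1))) := by
            rw [Finset.sum_const, nsmul_eq_mul, ENNReal.ofReal_mul (by positivity),
              ENNReal.ofReal_natCast]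
        _ ≤ ENNReal.ofReal δ := by
            refine ENNReal.ofReal_le_ofReal ?_
            rw [mul_div_assoc', div_le_iff₀ (by positivity)]
            linarith

end Limit

lemma lintegral_biSup_rpow_le_of_forall_finset {Ω τ : Type*}
    {m : MeasurableSpace Ω} {P : Measure Ω} {Z : τ → Ω → ℝ≥0∞}
    (hZ : ∀ t, Measurable (Z t)) {p : ℝ} (hp : 0 < p) {c : ℝ≥0∞} {C : Set τ} (hC : C.Countable)
    (h : ∀ S : Finset τ, ∫⁻ ω, (⨆ t ∈ S, Z t ω) ^ p ∂P ≤ c) :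
    ∫⁻ ω, (⨆ t ∈ C, Z t ω) ^ p ∂P ≤ c := by
  have := hC.to_subtype
  have := Encodable.ofCountable C
  let S : ℕ → Finset τ := fun n =>
    (Finset.range n).biUnion fun k => ((Encodable.decode k : Option C).map (↑)).toFinset
  have hS : Monotone S := fun i j hij =>
    Finset.biUnion_subset_biUnion_of_subset_left _ (Finset.range_mono hij)
  have hSC : ∀ t, t ∈ C ↔ ∃ n, t ∈ S n := fun t => by
    constructor
    · intro ht
      refine ⟨Encodable.encode (⟨t, ht⟩ : C) + 1, ?_⟩
      simp only [S, Finset.mem_biUnion, Finset.mem_range]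
      exact ⟨_, Nat.lt_succ_self _, by simp⟩
    · rintro ⟨n, hn⟩
      simp only [S, Finset.mem_biUnion, Finset.mem_range, Option.mem_toFinset, Option.mem_def,
        Option.map_eq_some_iff] at hn
      obtain ⟨-, -, s, -, rfl⟩ := hn
      exact s.2
  have hmono : Monotone fun n ω => (⨆ t ∈ S n, Z t ω) ^ p := fun i j hij ω =>
    ENNReal.rpow_le_rpow (biSup_mono fun t ht => hS hij ht) hp.le
  have hmeas : ∀ n, Measurable fun ω => (⨆ t ∈ S n, Z t ω) ^ p := fun n =>
    (Measurable.biSup (S n : Set τ) (S n).countable_toSet fun t _ => hZ t).pow_const p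
  have heq : ∀ ω, (⨆ t ∈ C, Z t ω) ^ p = ⨆ n, (⨆ t ∈ S n, Z t ω) ^ p := fun ω => by
    rw [← ENNReal.orderIsoRpow_apply p hp]
    simp only [← ENNReal.orderIsoRpow_apply p hp]
    rw [← OrderIso.map_iSup]
    congr 1
    simp only [hSC, iSup_exists]
    exact iSup_comm
  simp only [heq]
  rw [lintegral_iSup hmeas hmono]
  exact iSup_le fun n => h (S n)

lemma exists_memLp_ge_of_lintegral_iSup_ne_top {Ω X : Type*} {m : MeasurableSpace Ω}
    {P : Measure Ω} [IsProbabilityMeasure P] [NormedAddCommGroup X] {M : ℝ≥0 → Ω → X}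
    (hM : ∀ t, StronglyMeasurable (M t)) {p : ℝ} (hp : 1 ≤ p)
    (hMp : ∫⁻ ω, (⨆ t, ‖M t ω‖ₑ) ^ p ∂P ≠ ⊤) :
    ∃ g : Ω → ℝ, StronglyMeasurable g ∧ (∀ ω, 1 ≤ g ω) ∧ MemLp g (ENNReal.ofReal p) P ∧
      ∀ t, ∀ᵐ ω ∂P, ‖M t ω‖ ≤ g ω := by
  have hp0 : 0 < p := zero_lt_one.trans_le hp
  obtain ⟨C, hC, hCle⟩ := exists_countable_ae_le_iSup P fun t => (hM t).enorm
  let G : Ω → ℝ≥0∞ := fun ω => ⨆ t ∈ C, ‖M t ω‖ₑ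
  have hG : Measurable G := Measurable.biSup _ hC fun t _ => (hM t).enorm
  have hGp : ∫⁻ ω, G ω ^ p ∂P ≠ ⊤ := ne_top_of_le_ne_top hMp
    (lintegral_mono fun ω => ENNReal.rpow_le_rpow
      (iSup₂_le fun t _ => le_iSup (fun t => ‖M t ω‖ₑ) t) hp0.le)
  have hGtop : ∀ᵐ ω ∂P, G ω < ⊤ := by
    filter_upwards [ae_lt_top (hG.pow_const p) hGp] with ω hω
    exact (ENNReal.rpow_lt_top_iff_of_pos hp0).1 hω
  have hGL : MemLp (fun ω => (G ω).toReal) (ENNReal.ofReal p) P := by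
    refine ⟨hG.ennreal_toReal.aestronglyMeasurable, ?_⟩
    rw [eLpNorm_lt_top_iff_lintegral_rpow_enorm_lt_top (by simpa using hp0) ENNReal.ofReal_ne_top,
      ENNReal.toReal_ofReal hp0.le]
    refine lt_of_le_of_lt (lintegral_mono fun ω => ENNReal.rpow_le_rpow ?_ hp0.le) hGp.lt_top
    rw [Real.enorm_of_nonneg ENNReal.toReal_nonneg]
    exact ENNReal.ofReal_toReal_le
  refine ⟨fun ω => 1 + (G ω).toReal, (hG.ennreal_toReal.const_add 1).stronglyMeasurable,
    fun ω => le_add_of_nonneg_right ENNReal.toReal_nonneg, ?_, fun t => ?_⟩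
  · have h1 : MemLp (fun _ : Ω => (1 : ℝ)) (ENNReal.ofReal p) P := memLp_const 1
    exact h1.add hGL
  filter_upwards [hCle t, hGtop] with ω h1 h2
  have h3 : ‖M t ω‖ₑ ≤ G ω := h1.trans (biSup_mono fun s hs => hs.1)
  rw [← toReal_enorm]
  exact (ENNReal.toReal_mono h2.ne h3).trans (le_add_of_nonneg_left zero_le_one)

section Version

variable {Ω X : Type*} {m : MeasurableSpace Ω} {P : Measure Ω} [IsProbabilityMeasure P]
  [NormedAddCommGroup X] [NormedSpace ℝ X] [CompleteSpace X]

/-- Modifying a martingale on null events so that its distance to another martingale is controlled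
at all times simultaneously. -/
theorem exists_modification_lintegral_iSup_le {ℱ : Filtration ℝ≥0 m} {M N : ℝ≥0 → Ω → X}
    (hM : Martingale M ℱ P) (hN : Martingale N ℱ P) {p : ℝ} (hp : 0 < p) {c : ℝ≥0∞}
    (h : ∀ S : Finset ℝ≥0, ∫⁻ ω, (⨆ t ∈ S, ‖M t ω - N t ω‖ₑ) ^ p ∂P ≤ c) :
    ∃ N' : ℝ≥0 → Ω → X, Martingale N' ℱ P ∧ (∀ t, N' t =ᵐ[P] N t) ∧
      ∫⁻ ω, (⨆ t, ‖M t ω - N' t ω‖ₑ) ^ p ∂P ≤ c := by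
  have hZ : ∀ t, Measurable[ℱ t] fun ω => ‖M t ω - N t ω‖ₑ := fun t =>
    ((hM.1 t).sub (hN.1 t)).enorm
  have hZm : ∀ t, Measurable fun ω => ‖M t ω - N t ω‖ₑ := fun t => (hZ t).mono (ℱ.le t) le_rfl
  obtain ⟨C, hC, hCle⟩ := exists_countable_ae_le_iSup P hZm
  let A : ℝ≥0 → Set Ω := fun t =>
    {ω | ‖M t ω - N t ω‖ₑ ≤ ⨆ s ∈ C ∩ Set.Iic t, ‖M s ω - N s ω‖ₑ}
  have hA : ∀ t, MeasurableSet[ℱ t] (A t) := fun t =>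
    measurableSet_le (hZ t) (Measurable.biSup _ (hC.mono Set.inter_subset_left) fun s hs =>
      (hZ s).mono (ℱ.mono hs.2) le_rfl)
  let N' : ℝ≥0 → Ω → X := fun t => (A t).piecewise (N t) (M t)
  have hN' : ∀ t, N' t =ᵐ[P] N t := fun t => by
    filter_upwards [hCle t] with ω hω
    exact Set.piecewise_eq_of_mem _ _ _ hω
  refine ⟨N', ⟨fun t => StronglyMeasurable.piecewise (hA t) (hN.1 t) (hM.1 t),
    fun s t hst => ?_⟩, hN', ?_⟩
  · exact ((condExp_congr_ae (hN' t)).trans (hN.2 s t hst)).trans (hN' s).symm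
  · refine (lintegral_mono fun ω => ENNReal.rpow_le_rpow (iSup_le fun t => ?_) hp.le).trans
      (lintegral_biSup_rpow_le_of_forall_finset hZm hp hC h)
    by_cases hω : ω ∈ A t
    · rw [show N' t ω = N t ω from Set.piecewise_eq_of_mem _ _ _ hω]
      exact le_trans hω (biSup_mono fun s hs => hs.1)
    · rw [show N' t ω = M t ω from Set.piecewise_eq_of_notMem _ _ _ hω]
      simp

end Version

/-- **Approximation of martingales by uniformly bounded martingales** (Theorem 7.8).
Let `X` be a UMD Banach space, `1 ≤ p < ∞`, and `M : ℝ₊ × Ω → X` a martingale with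
`E sup_{t ≥ 0} ‖M_t‖^p < ∞`. Then there is a sequence `(M^n)` of `L^∞`-bounded `X`-valued
martingales with `E sup_{t ≥ 0} ‖M_t - M^n_t‖^p → 0` as `n → ∞`. -/
theorem martingale_approximation
    (X : Type*) [NormedAddCommGroup X] [NormedSpace ℝ X] [CompleteSpace X]
    (hX : IsUMD X) (p : ℝ) (hp : 1 ≤ p)
    (Ω : Type*) (m : MeasurableSpace Ω) (P : Measure Ω) (hP : IsProbabilityMeasure P)
    (ℱ : Filtration ℝ≥0 m) (M : ℝ≥0 → Ω → X) (hM : Martingale M ℱ P)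
    (hMp : (∫⁻ ω, (⨆ t : ℝ≥0, (‖M t ω‖₊ : ℝ≥0∞)) ^ p ∂P) ≠ ⊤) :
    ∃ Mn : ℕ → ℝ≥0 → Ω → X,
      (∀ n, Martingale (Mn n) ℱ P) ∧
      (∀ n, ∃ R : ℝ, ∀ t : ℝ≥0, ∀ᵐ ω ∂P, ‖Mn n t ω‖ ≤ R) ∧
      Tendsto (fun n => ∫⁻ ω, (⨆ t : ℝ≥0, (‖M t ω - Mn n t ω‖₊ : ℝ≥0∞)) ^ p ∂P)
        atTop (𝓝 0) := by
  obtain ⟨g, hgm, hg1, hg, hMg⟩ :=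
    exists_memLp_ge_of_lintegral_iSup_ne_top (fun t => (hM.1 t).mono (ℱ.le t)) hp hMp
  have key : ∀ n : ℕ, ∃ N : ℝ≥0 → Ω → X, Martingale N ℱ P ∧
      (∃ R : ℝ, ∀ t : ℝ≥0, ∀ᵐ ω ∂P, ‖N t ω‖ ≤ R) ∧
      ∫⁻ ω, (⨆ t : ℝ≥0, (‖M t ω - N t ω‖₊ : ℝ≥0∞)) ^ p ∂P ≤
        ENNReal.ofReal (1 / (n + 1)) ^ p := fun n => by
    obtain ⟨R, N, hN, hNR, hMN⟩ := exists_bounded_martingale_close hM hp hgm hg1 hg hMg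
      (ε := 1 / (n + 1)) Nat.one_div_pos_of_nat
    obtain ⟨N', hN', hNN', hle⟩ :=
      exists_modification_lintegral_iSup_le hM hN (zero_lt_one.trans_le hp) hMN
    refine ⟨N', hN', ⟨R, fun t => ?_⟩, hle⟩
    filter_upwards [hNN' t, hNR t] with ω h1 h2
    rwa [h1]
  choose N hN hNR hle using key
  refine ⟨N, hN, hNR, tendsto_of_tendsto_of_tendsto_of_le_of_le tendsto_const_nhds ?_
    (fun _ => zero_le) hle⟩
  have h1 := ENNReal.tendsto_ofReal tendsto_one_div_add_atTop_nhds_zero_nat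
  have h2 := ((ENNReal.continuous_rpow_const (y := p)).tendsto _).comp h1
  rwa [ENNReal.ofReal_zero, ENNReal.zero_rpow_of_pos (zero_lt_one.trans_le hp)] at h2

end
end

section
/- Let X be a Banach space whose Gaussian type 2 constant equals 1, i.e. for every finite sequence (x_i)_{i=1}^n in X and independent standard Gaussian random variables (ξ_i)_{i=1}^n one has E ‖Σ_{i=1}^n ξ_i x_i‖² ≤ Σ_{i=1}^n ‖x_i‖². Then X is a Hilbert space, i.e. its norm is induced by an inner product. -/
open MeasureTheory ProbabilityTheory Filter
open scoped ENNReal NNReal Topology InnerProductSpace Classical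

noncomputable section

/-- The law of `N` i.i.d. standard Gaussian random variables. -/
def gaussianPi (N : ℕ) : Measure (Fin N → ℝ) :=
  Measure.pi fun _ => gaussianReal 0 1

/-- The standard Gaussian measure on a finite-dimensional inner product space charges every
nonempty open set. -/
lemma isOpenPosMeasure_stdGaussian {E : Type*} [NormedAddCommGroup E] [InnerProductSpace ℝ E]
    [FiniteDimensional ℝ E] [MeasurableSpace E] [BorelSpace E] :
    (stdGaussian E).IsOpenPosMeasure := by
  have : (gaussianReal 0 1).IsOpenPosMeasure :=
    (gaussianReal_absolutelyContinuous' 0 one_ne_zero).isOpenPosMeasure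
  refine Continuous.isOpenPosMeasure_map (by fun_prop) fun v => ?_
  exact ⟨fun i => (stdOrthonormalBasis ℝ E).repr v i, (stdOrthonormalBasis ℝ E).sum_repr v⟩

/-- The standard Gaussian measure on `ℂ` is invariant under multiplication by unit complex
numbers. -/
lemma measurePreserving_circle_mul (u : Circle) :
    MeasurePreserving (fun w : ℂ => u * w) (stdGaussian ℂ) (stdGaussian ℂ) :=
  ⟨by fun_prop, stdGaussian_map (rotation u)⟩

/-- A dual functional has second moment `‖L‖ ^ 2` under the standard Gaussian measure. -/
lemma integral_dual_sq_stdGaussian {E : Type*} [NormedAddCommGroup E] [InnerProductSpace ℝ E]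
    [FiniteDimensional ℝ E] [MeasurableSpace E] [BorelSpace E] (L : StrongDual ℝ E) :
    ∫ z, L z ^ 2 ∂stdGaussian E = ‖L‖ ^ 2 := by
  rw [← variance_dual_stdGaussian, variance_eq_integral (by fun_prop)]
  simp

lemma integrable_norm_sq_stdGaussian {E : Type*} [NormedAddCommGroup E] [InnerProductSpace ℝ E]
    [FiniteDimensional ℝ E] [MeasurableSpace E] [BorelSpace E] :
    Integrable (fun z : E => ‖z‖ ^ 2) (stdGaussian E) :=
  (IsGaussian.memLp_two_id (μ := stdGaussian E)).integrable_norm_pow two_ne_zero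

lemma integral_norm_sq_stdGaussian_complex : ∫ z : ℂ, ‖z‖ ^ 2 ∂stdGaussian ℂ = 2 := by
  have hL (L : StrongDual ℝ ℂ) : Integrable (fun z => L z ^ 2) (stdGaussian ℂ) :=
    (IsGaussian.memLp_dual (stdGaussian ℂ) L 2 (by simp)).integrable_sq
  have hz (z : ℂ) : ‖z‖ ^ 2 = Complex.reCLM z ^ 2 + Complex.imCLM z ^ 2 := by
    rw [Complex.sq_norm, Complex.normSq_apply, Complex.reCLM_apply, Complex.imCLM_apply]
    ring
  simp_rw [hz]
  rw [integral_add (hL _) (hL _), integral_dual_sq_stdGaussian, integral_dual_sq_stdGaussian]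
  norm_num

/-- Integration against `gaussianPi 2` is integration against the standard Gaussian measure
on `ℂ`. -/
lemma lintegral_stdGaussian_complex {f : ℂ → ℝ≥0∞} (hf : Measurable f) :
    ∫⁻ z, f z ∂stdGaussian ℂ = ∫⁻ g, f (g 0 + g 1 * Complex.I) ∂gaussianPi 2 := by
  rw [stdGaussian_eq_map_pi_orthonormalBasis Complex.orthonormalBasisOneI,
    lintegral_map hf (by fun_prop)]
  simp [gaussianPi, Fin.sum_univ_two]

/-- If a nonnegative continuous function `φ` on `ℂ`, homogeneous of degree two, is such that
`φ z + φ (i z)` always dominates the Gaussian average of `w ↦ φ (z w)`, then equality holds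
everywhere. -/
lemma add_I_mul_eq_of_lintegral_le {φ : ℂ → ℝ} (hc : Continuous φ) (h0 : ∀ z, 0 ≤ φ z)
    (hs : ∀ (r : ℝ) z, φ (r * z) = r ^ 2 * φ z)
    (hφ : ∀ z, ∫⁻ w, ENNReal.ofReal (φ (z * w)) ∂stdGaussian ℂ ≤
      ENNReal.ofReal (φ z + φ (Complex.I * z))) (z : ℂ) :
    φ z + φ (Complex.I * z) = ‖z‖ ^ 2 * ∫ w, φ w ∂stdGaussian ℂ := by
  have hint : Integrable φ (stdGaussian ℂ) := by
    refine ⟨hc.aestronglyMeasurable, ?_⟩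
    rw [hasFiniteIntegral_iff_ofReal (ae_of_all _ h0)]
    simpa using (hφ 1).trans_lt ENNReal.ofReal_lt_top
  have hrot (u : Circle) : ∫ w, φ (u * w) ∂stdGaussian ℂ = ∫ w, φ w ∂stdGaussian ℂ :=
    (measurePreserving_circle_mul u).integral_comp
      (rotation u).toHomeomorph.measurableEmbedding φ
  have hrotint (u : Circle) : Integrable (fun w => φ (u * w)) (stdGaussian ℂ) :=
    (measurePreserving_circle_mul u).integrable_comp_of_integrable hint
  have hpolar (z : ℂ) : ∃ u : Circle, ∀ w, φ (z * w) = ‖z‖ ^ 2 * φ (u * w) := by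
    refine ⟨Circle.exp z.arg, fun w => ?_⟩
    rw [← hs, ← mul_assoc, Circle.coe_exp, Complex.norm_mul_exp_arg_mul_I]
  have hle (z : ℂ) : ‖z‖ ^ 2 * ∫ w, φ w ∂stdGaussian ℂ ≤ φ z + φ (Complex.I * z) := by
    obtain ⟨u, hu⟩ := hpolar z
    have hz := hφ z
    simp_rw [hu] at hz
    rw [← ofReal_integral_eq_lintegral_ofReal ((hrotint u).const_mul _)
      (ae_of_all _ fun w => mul_nonneg (sq_nonneg _) (h0 _)),
      ENNReal.ofReal_le_ofReal_iff (add_nonneg (h0 _) (h0 _)), integral_const_mul, hrot] at hz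
    exact hz
  let i : Circle := ⟨Complex.I, by simp [Submonoid.unitSphere]⟩
  have hIint : Integrable (fun w => φ (Complex.I * w)) (stdGaussian ℂ) := hrotint i
  have hI : ∫ w, φ (Complex.I * w) ∂stdGaussian ℂ = ∫ w, φ w ∂stdGaussian ℂ := hrot i
  have hsum : Integrable (fun z => φ z + φ (Complex.I * z)) (stdGaussian ℂ) := hint.add hIint
  set e := ∫ w, φ w ∂stdGaussian ℂ
  have hnint : Integrable (fun z : ℂ => ‖z‖ ^ 2 * e) (stdGaussian ℂ) :=
    integrable_norm_sq_stdGaussian.mul_const e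
  have hzero : ∫ z, (φ z + φ (Complex.I * z) - ‖z‖ ^ 2 * e) ∂stdGaussian ℂ = 0 := by
    rw [integral_sub hsum hnint, integral_add hint hIint, hI, integral_mul_const,
      integral_norm_sq_stdGaussian_complex]
    ring
  rw [integral_eq_zero_iff_of_nonneg (fun z => sub_nonneg.2 (hle z))
    (hsum.sub hnint)] at hzero
  have := isOpenPosMeasure_stdGaussian (E := ℂ)
  have hcont : Continuous fun z : ℂ => φ z + φ (Complex.I * z) - ‖z‖ ^ 2 * e := by fun_prop
  have heq := (Continuous.ae_eq_iff_eq (stdGaussian ℂ) hcont continuous_const).1 hzero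
  exact sub_eq_zero.1 (congrFun heq z)

/-- A real normed space satisfying the Gaussian type 2 inequality with constant one for pairs of
vectors satisfies the parallelogram identity. -/
lemma parallelogram_of_gaussian_type_two {X : Type*} [NormedAddCommGroup X] [NormedSpace ℝ X]
    (h : ∀ x : Fin 2 → X,
      (∫⁻ g : Fin 2 → ℝ, (‖∑ i : Fin 2, g i • x i‖₊ : ℝ≥0∞) ^ 2 ∂ gaussianPi 2) ≤
        ENNReal.ofReal (∑ i : Fin 2, ‖x i‖ ^ 2)) :
    InnerProductSpaceable X := by
  refine ⟨fun x y => ?_⟩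
  let φ : ℂ → ℝ := fun z => ‖z.re • x + z.im • y‖ ^ 2
  have hc : Continuous φ := by fun_prop
  have key : ∀ z, φ z + φ (Complex.I * z) = ‖z‖ ^ 2 * ∫ w, φ w ∂stdGaussian ℂ := by
    refine add_I_mul_eq_of_lintegral_le hc (fun z => sq_nonneg _) (fun r z => ?_) fun z => ?_
    · simp only [φ, Complex.re_ofReal_mul, Complex.im_ofReal_mul, mul_smul, ← smul_add, norm_smul,
        mul_pow, Real.norm_eq_abs, sq_abs]
    · rw [lintegral_stdGaussian_complex (by fun_prop)]
      convert h ![z.re • x + z.im • y, -z.im • x + z.re • y] using 3 with g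
      · rw [← enorm_eq_nnnorm, ← ofReal_norm, ← ENNReal.ofReal_pow (norm_nonneg _)]
        simp only [φ, Fin.sum_univ_two]
        congr 3
        simp
        module
      · simp [φ, Fin.sum_univ_two]
  have h1 := key 1
  have h2 := key (1 + Complex.I)
  have h3 : ‖(1 + Complex.I : ℂ)‖ ^ 2 = 2 := by
    rw [Complex.sq_norm, Complex.normSq_apply]
    norm_num
  rw [h3] at h2
  have h4 : ‖-x + y‖ = ‖x - y‖ := by rw [neg_add_eq_sub, norm_sub_rev]
  simp [φ, h4] at h1 h2
  linarith

/-- **Gaussian type 2 constant one implies Hilbert** (Proposition 3.5).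
Let `X` be a Banach space whose Gaussian type 2 constant equals `1`, i.e.
`E‖Σ_i ξ_i x_i‖² ≤ Σ_i ‖x_i‖²` for all finite sequences `(x_i)` in `X` and independent
standard Gaussian variables `(ξ_i)`. Then `X` is a Hilbert space: its norm is induced by
an inner product. -/
theorem hilbert_of_gaussian_type_two_constant_one
    (X : Type*) [NormedAddCommGroup X] [NormedSpace ℝ X]
    (h : ∀ (n : ℕ) (x : Fin n → X),
      (∫⁻ g : Fin n → ℝ, (‖∑ i : Fin n, g i • x i‖₊ : ℝ≥0∞) ^ 2 ∂ gaussianPi n) ≤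
        ENNReal.ofReal (∑ i : Fin n, ‖x i‖ ^ 2)) :
    ∃ inner : X → X → ℝ,
      (∀ x y : X, inner x y = inner y x) ∧
      (∀ x y z : X, inner (x + y) z = inner x z + inner y z) ∧
      (∀ (c : ℝ) (x y : X), inner (c • x) y = c * inner x y) ∧
      (∀ x : X, inner x x = ‖x‖ ^ 2) := by
  have hX : InnerProductSpaceable X := parallelogram_of_gaussian_type_two (h 2)
  let _ : InnerProductSpace ℝ X := InnerProductSpace.ofNorm ℝ hX.parallelogram_identity
  exact ⟨fun x y => ⟪x, y⟫_ℝ, fun x y => real_inner_comm y x, inner_add_left,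
    fun c x y => real_inner_smul_left x y c, real_inner_self_eq_norm_sq⟩

end
end

section
/- Let X be a reflexive Banach space and V, W : X* × X* → ℝ symmetric continuous nonnegative bilinear forms. Then γ(V + W) ≤ γ(V) + γ(W). -/
open MeasureTheory ProbabilityTheory Filter
open scoped ENNReal NNReal Topology InnerProductSpace Classical

noncomputable section

/-- `V` is a continuous (bounded) nonnegative symmetric bilinear form. -/
def IsContNonnegSymmBilinear {E : Type*} [NormedAddCommGroup E] [NormedSpace ℝ E]
    (V : E → E → ℝ) : Prop :=
  (∀ f g h, V (f + g) h = V f h + V g h) ∧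
  (∀ (c : ℝ) f g, V (c • f) g = c * V f g) ∧
  (∀ f g, V f g = V g f) ∧
  (∀ f, 0 ≤ V f f) ∧
  ∃ C : ℝ, ∀ f g, |V f g| ≤ C * ‖f‖ * ‖g‖

/-- The Gaussian characteristic `γ(V)` of a bilinear form `V` on `X* × X*`: the `L²`-norm
`(E‖ξ‖²)^{1/2}` of a centered `X`-valued Gaussian random variable `ξ` whose covariance
bilinear form is `V`, and `∞` if no such Gaussian random variable exists. -/
noncomputable def gaussianChar (X : Type*) [NormedAddCommGroup X] [NormedSpace ℝ X]
    (V : (X →L[ℝ] ℝ) → (X →L[ℝ] ℝ) → ℝ) : ℝ≥0∞ :=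
  letI : MeasurableSpace X := borel X
  sInf { c : ℝ≥0∞ | ∃ μ : Measure X, IsProbabilityMeasure μ ∧
    (∀ f : X →L[ℝ] ℝ, ∃ v : ℝ≥0, μ.map f = gaussianReal 0 v) ∧
    (∀ f g : X →L[ℝ] ℝ, ∫ x, f x * g x ∂μ = V f g) ∧
    c = (∫⁻ x, (‖x‖₊ : ℝ≥0∞) ^ 2 ∂μ) ^ (1 / 2 : ℝ) }

open TopologicalSpace in
/-- A separable subspace is normed, through a pairing with attained norms, by a separable one. -/
lemma exists_isSeparable_norming {E F : Type*} [NormedAddCommGroup E]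
    [NormedSpace ℝ E] [NormedAddCommGroup F] [NormedSpace ℝ F] (B : E → F → ℝ)
    (hB : ∀ e e' f, B e f - B e' f ≤ ‖e - e'‖ * ‖f‖)
    (hN : ∀ e, ∃ f, ‖f‖ ≤ 1 ∧ B e f = ‖e‖) {S : Set E} (hS : IsSeparable S) :
    ∃ T : Submodule ℝ F, IsSeparable (T : Set F) ∧
      ∀ e ∈ S, ∀ ε > 0, ∃ f ∈ T, ‖f‖ ≤ 1 ∧ ‖e‖ - ε ≤ B e f := by
  choose N hN1 hN2 using hN
  obtain ⟨c, hc, hSc⟩ := hS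
  refine ⟨Submodule.span ℝ (N '' c), (hc.image N).isSeparable.span, fun e he ε hε ↦ ?_⟩
  obtain ⟨d, hd, hed⟩ := Metric.mem_closure_iff.1 (hSc he) (ε / 2) (half_pos hε)
  refine ⟨N d, Submodule.subset_span ⟨d, hd, rfl⟩, hN1 d, ?_⟩
  have h1 := hB d e (N d)
  have h2 : ‖d - e‖ * ‖N d‖ ≤ ‖d - e‖ := mul_le_of_le_one_right (norm_nonneg _) (hN1 d)
  have h3 : ‖e‖ ≤ ‖d‖ + ‖d - e‖ := by
    simpa [norm_sub_rev, add_comm] using norm_le_norm_add_norm_sub' e d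
  rw [dist_comm, dist_eq_norm] at hed
  rw [hN2] at h1
  linarith

section Reflexive

variable {X : Type*} [NormedAddCommGroup X] [NormedSpace ℝ X]

/-- In a reflexive space every functional attains its norm on the closed unit ball. -/
lemma exists_norm_le_one_apply_eq_norm
    (hrefl : Function.Surjective (NormedSpace.inclusionInDoubleDual ℝ X)) (f : X →L[ℝ] ℝ) :
    ∃ x : X, ‖x‖ ≤ 1 ∧ f x = ‖f‖ := by
  obtain ⟨ψ, hψ, hf⟩ := exists_dual_vector'' ℝ f
  obtain ⟨x, rfl⟩ := hrefl ψ
  refine ⟨x, ?_, by simpa using hf⟩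
  rwa [← (NormedSpace.inclusionInDoubleDualLi ℝ (E := X)).norm_map x]

open TopologicalSpace in
/-- Separable subspaces of a reflexive space and of its dual can be enlarged to separable
subspaces that norm each other. -/
lemma exists_isSeparable_mutually_norming
    (hrefl : Function.Surjective (NormedSpace.inclusionInDoubleDual ℝ X))
    {A : Set X} (hA : IsSeparable A) {B : Set (X →L[ℝ] ℝ)} (hB : IsSeparable B) :
    ∃ (S : Submodule ℝ X) (R : Submodule ℝ (X →L[ℝ] ℝ)),
      A ⊆ S ∧ B ⊆ R ∧ IsSeparable (S : Set X) ∧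
      (∀ f ∈ R, ∀ ε > 0, ∃ x ∈ S, ‖x‖ ≤ 1 ∧ ‖f‖ - ε ≤ f x) ∧
      ∀ x ∈ S, ∀ ε > 0, ∃ f ∈ R, ‖f‖ ≤ 1 ∧ ‖x‖ - ε ≤ f x := by
  let Sep := {p : Submodule ℝ X × Submodule ℝ (X →L[ℝ] ℝ) //
    IsSeparable (p.1 : Set X) ∧ IsSeparable (p.2 : Set (X →L[ℝ] ℝ))}
  have step (p : Sep) : ∃ q : Sep, p.1 ≤ q.1 ∧
      (∀ f ∈ p.1.2, ∀ ε > 0, ∃ x ∈ q.1.1, ‖x‖ ≤ 1 ∧ ‖f‖ - ε ≤ f x) ∧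
      ∀ x ∈ p.1.1, ∀ ε > 0, ∃ f ∈ q.1.2, ‖f‖ ≤ 1 ∧ ‖x‖ - ε ≤ f x := by
    obtain ⟨T, hT, hTn⟩ := exists_isSeparable_norming (fun (f : X →L[ℝ] ℝ) x ↦ f x)
      (fun f g x ↦ by simpa using (le_abs_self _).trans ((f - g).le_opNorm x))
      (exists_norm_le_one_apply_eq_norm hrefl) p.2.2
    obtain ⟨U, hU, hUn⟩ := exists_isSeparable_norming (fun x (f : X →L[ℝ] ℝ) ↦ f x)
      (fun x y f ↦ by
        simpa [mul_comm] using (le_abs_self _).trans (f.le_opNorm (x - y)))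
      (fun x ↦ by simpa using exists_dual_vector'' ℝ x) p.2.1
    have hsup {E : Type _} [NormedAddCommGroup E] [NormedSpace ℝ E] {P Q : Submodule ℝ E}
        (hP : IsSeparable (P : Set E)) (hQ : IsSeparable (Q : Set E)) :
        IsSeparable ((P ⊔ Q : Submodule ℝ E) : Set E) := by
      rw [← Submodule.span_eq P, ← Submodule.span_eq Q, ← Submodule.span_union]
      exact (hP.union hQ).span
    refine ⟨⟨(p.1.1 ⊔ T, p.1.2 ⊔ U), hsup p.2.1 hT, hsup p.2.2 hU⟩,
      ⟨le_sup_left, le_sup_left⟩, fun f hf ε hε ↦ ?_, fun x hx ε hε ↦ ?_⟩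
    · obtain ⟨x, hx, h⟩ := hTn f hf ε hε
      exact ⟨x, Submodule.mem_sup_right hx, h⟩
    · obtain ⟨f, hf, h⟩ := hUn x hx ε hε
      exact ⟨f, Submodule.mem_sup_right hf, h⟩
  choose next hle hnS hnR using step
  let p (n : ℕ) : Sep :=
    next^[n] ⟨(Submodule.span ℝ A, Submodule.span ℝ B), hA.span, hB.span⟩
  have hp (n : ℕ) : p (n + 1) = next (p n) := Function.iterate_succ_apply' _ _ _
  have hmono : Monotone fun n ↦ (p n).1 := monotone_nat_of_le_succ fun n ↦ by
    rw [hp]; exact hle _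
  have hS : Monotone fun n ↦ (p n).1.1 := fun m n h ↦ (hmono h).1
  have hR : Monotone fun n ↦ (p n).1.2 := fun m n h ↦ (hmono h).2
  refine ⟨⨆ n, (p n).1.1, ⨆ n, (p n).1.2,
    Submodule.subset_span.trans (SetLike.coe_subset_coe.2 (le_iSup (fun n ↦ (p n).1.1) 0)),
    Submodule.subset_span.trans (SetLike.coe_subset_coe.2 (le_iSup (fun n ↦ (p n).1.2) 0)),
    ?_, fun f hf ε hε ↦ ?_, fun x hx ε hε ↦ ?_⟩
  · rw [Submodule.coe_iSup_of_directed _ hS.directed_le]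
    exact IsSeparable.iUnion fun n ↦ (p n).2.1
  · obtain ⟨n, hn⟩ := (Submodule.mem_iSup_of_directed _ hR.directed_le).1 hf
    obtain ⟨x, hx, h⟩ := hnS (p n) f hn ε hε
    rw [← hp] at hx
    exact ⟨x, Submodule.mem_iSup_of_mem (n + 1) hx, h⟩
  · obtain ⟨n, hn⟩ := (Submodule.mem_iSup_of_directed _ hS.directed_le).1 hx
    obtain ⟨f, hf, h⟩ := hnR (p n) x hn ε hε
    rw [← hp] at hf
    exact ⟨f, Submodule.mem_iSup_of_mem (n + 1) hf, h⟩

set_option maxSynthPendingDepth 3 in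
/-- If a closed subspace `Y` of a reflexive space norms the subspace `R` of the dual, then every
vector agrees on `R` with a vector of `Y` of no larger norm. -/
lemma exists_mem_forall_apply_eq
    (hrefl : Function.Surjective (NormedSpace.inclusionInDoubleDual ℝ X))
    {Y : Submodule ℝ X} (hY : IsClosed (Y : Set X)) {R : Submodule ℝ (X →L[ℝ] ℝ)}
    (hR : ∀ f ∈ R, ‖f‖ ≤ ‖f.comp Y.subtypeL‖) (x : X) :
    ∃ y ∈ Y, ‖y‖ ≤ ‖x‖ ∧ ∀ f ∈ R, f y = f x := by
  let r : StrongDual ℝ X →L[ℝ] StrongDual ℝ Y :=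
    (ContinuousLinearMap.compL ℝ Y X ℝ).flip Y.subtypeL
  have hrle (f : X →L[ℝ] ℝ) : ‖r f‖ ≤ ‖f‖ :=
    ContinuousLinearMap.opNorm_le_bound _ (norm_nonneg _) fun y ↦ f.le_opNorm y
  obtain ⟨g, hgR, hg⟩ := exists_extension_of_le_sublinear
    ⟨R, (NormedSpace.inclusionInDoubleDual ℝ X x).toLinearMap.domRestrict R⟩
    (fun f ↦ ‖x‖ * ‖r f‖)
    (fun c hc f ↦ by rw [map_smul, norm_smul, Real.norm_of_nonneg hc.le]; ring)
    (fun f h ↦ by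
      rw [map_add, ← mul_add]
      exact mul_le_mul_of_nonneg_left (norm_add_le _ _) (norm_nonneg _))
    (fun f ↦ by
      calc (f : X →L[ℝ] ℝ) x ≤ ‖(f : X →L[ℝ] ℝ)‖ * ‖x‖ :=
            (le_abs_self _).trans ((f : X →L[ℝ] ℝ).le_opNorm x)
        _ = ‖x‖ * ‖(f : X →L[ℝ] ℝ)‖ := mul_comm _ _
        _ ≤ _ := mul_le_mul_of_nonneg_left (hR _ f.2) (norm_nonneg _))
  have hgabs (f : X →L[ℝ] ℝ) : ‖g f‖ ≤ ‖x‖ * ‖r f‖ := by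
    refine abs_le'.2 ⟨hg f, ?_⟩
    have := hg (-f)
    rwa [map_neg, map_neg, norm_neg] at this
  obtain ⟨y, hy⟩ := hrefl (g.mkContinuous ‖x‖ fun f ↦ (hgabs f).trans
    (mul_le_mul_of_nonneg_left (hrle f) (norm_nonneg _)))
  have hyg (f : X →L[ℝ] ℝ) : f y = g f := by
    simpa using DFunLike.congr_fun hy f
  refine ⟨y, ?_, ?_, fun f hf ↦ (hyg f).trans (hgR ⟨f, hf⟩)⟩
  · by_contra hyY
    obtain ⟨φ, hφ⟩ := SeparatingDual.exists_ne_zero (R := ℝ) (x := Y.mkQ y)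
      (by simpa using hyY)
    let f : X →L[ℝ] ℝ := φ.comp Y.mkQL
    have h0 : r f = 0 := by
      ext z
      have hz : Y.mkQ (z : X) = 0 := by simp
      change φ (Y.mkQ z) = 0
      rw [hz, map_zero]
    have := hgabs f
    rw [h0, ← hyg, norm_zero, mul_zero, norm_le_zero_iff] at this
    exact hφ this
  · obtain ⟨f, hf, hfy⟩ := exists_dual_vector'' ℝ y
    have := (le_abs_self _).trans (hgabs f)
    rw [← hyg, hfy] at this
    exact this.trans (mul_le_of_le_one_right (norm_nonneg _) ((hrle f).trans hf))

open TopologicalSpace in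
/-- **Lindenstrauss' projection**: in a reflexive space, any separable sets of vectors and of
functionals are fixed by a contraction with separable range. -/
lemma exists_contraction_isSeparable_range
    (hrefl : Function.Surjective (NormedSpace.inclusionInDoubleDual ℝ X))
    {A : Set X} (hA : IsSeparable A) {B : Set (X →L[ℝ] ℝ)} (hB : IsSeparable B) :
    ∃ P : X →L[ℝ] X, (∀ x, ‖P x‖ ≤ ‖x‖) ∧ IsSeparable (Set.range P) ∧
      (∀ x ∈ A, P x = x) ∧ ∀ f ∈ B, ∀ x, f (P x) = f x := by
  obtain ⟨S, R, hAS, hBR, hS, hSn, hRn⟩ := exists_isSeparable_mutually_norming hrefl hA hB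
  let Y := S.topologicalClosure
  have eq_zero {y : X} (hy : y ∈ Y) (h : ∀ f ∈ R, f y = 0) : y = 0 := by
    rw [← norm_le_zero_iff]
    refine le_of_forall_pos_le_add fun ε hε ↦ ?_
    obtain ⟨s, hs, hys⟩ := Metric.mem_closure_iff.1 hy (ε / 3) (by positivity)
    obtain ⟨f, hf, hf1, hfs⟩ := hRn s hs (ε / 3) (by positivity)
    have h1 : f s ≤ ‖s - y‖ := by
      calc f s = f (s - y) := by simp [h f hf]
        _ ≤ ‖f‖ * ‖s - y‖ := (le_abs_self _).trans (f.le_opNorm _)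
        _ ≤ ‖s - y‖ := mul_le_of_le_one_left (norm_nonneg _) hf1
    have h2 := norm_le_norm_add_norm_sub' y s
    rw [dist_eq_norm] at hys
    rw [norm_sub_rev] at h1
    linarith
  have hRY (f : X →L[ℝ] ℝ) (hf : f ∈ R) : ‖f‖ ≤ ‖f.comp Y.subtypeL‖ := by
    refine le_of_forall_pos_le_add fun ε hε ↦ ?_
    obtain ⟨s, hs, hs1, hfs⟩ := hSn f hf ε hε
    have h1 : f s ≤ ‖f.comp Y.subtypeL‖ :=
      ((le_abs_self _).trans
        ((f.comp Y.subtypeL).le_opNorm ⟨s, S.le_topologicalClosure hs⟩)).trans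
        (mul_le_of_le_one_right (norm_nonneg _) hs1)
    linarith
  choose P hPY hPn hPR using
    exists_mem_forall_apply_eq hrefl S.isClosed_topologicalClosure hRY
  have uniq {x y : X} (hy : y ∈ Y) (h : ∀ f ∈ R, f y = f x) : P x = y := by
    rw [← sub_eq_zero]
    exact eq_zero (Y.sub_mem (hPY x) hy) fun f hf ↦ by rw [map_sub, hPR x f hf, h f hf, sub_self]
  let L : X →ₗ[ℝ] X :=
    { toFun := P
      map_add' := fun x y ↦ uniq (Y.add_mem (hPY x) (hPY y)) fun f hf ↦ by
        rw [map_add, map_add, hPR x f hf, hPR y f hf]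
      map_smul' := fun c x ↦ uniq (Y.smul_mem c (hPY x)) fun f hf ↦ by
        rw [map_smul, RingHom.id_apply, map_smul, hPR x f hf] }
  refine ⟨L.mkContinuous 1 fun x ↦ by
    rw [one_mul]; exact hPn x, hPn, ?_, fun x hx ↦ ?_, fun f hf x ↦ ?_⟩
  · exact hS.closure.mono (by rintro _ ⟨x, rfl⟩; exact hPY x)
  · exact uniq (S.le_topologicalClosure (hAS hx)) fun _ _ ↦ rfl
  · exact hPR x f (hBR hf)

end Reflexive

section Borel

variable {X : Type*} [NormedAddCommGroup X] [NormedSpace ℝ X] [MeasurableSpace X] [BorelSpace X]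
  {μ : Measure X}

lemma memLp_dual (hμ : MemLp (fun x : X ↦ ‖x‖) 2 μ) (f : X →L[ℝ] ℝ) : MemLp f 2 μ :=
  hμ.of_le_mul (c := ‖f‖) f.continuous.aestronglyMeasurable
    (ae_of_all _ fun x ↦ by simpa using f.le_opNorm x)

/-- The natural map from the dual to `L²(μ)`, for a measure whose norm is square integrable. -/
def dualToL2 (hμ : MemLp (fun x : X ↦ ‖x‖) 2 μ) : (X →L[ℝ] ℝ) →L[ℝ] Lp ℝ 2 μ :=
  LinearMap.mkContinuous
    { toFun := fun f ↦ (memLp_dual hμ f).toLp f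
      map_add' := fun f g ↦ MemLp.toLp_add (memLp_dual hμ f) (memLp_dual hμ g)
      map_smul' := fun c f ↦ MemLp.toLp_const_smul c (memLp_dual hμ f) }
    ‖hμ.toLp‖ fun f ↦ by
      rw [mul_comm]
      refine Lp.norm_le_mul_norm_of_ae_le_mul ?_
      filter_upwards [(memLp_dual hμ f).coeFn_toLp, hμ.coeFn_toLp] with x hx hx'
      change ‖(memLp_dual hμ f).toLp f x‖ ≤ _
      rw [hx, hx', norm_norm]
      exact f.le_opNorm x

lemma dualToL2_apply (hμ : MemLp (fun x : X ↦ ‖x‖) 2 μ) (f : X →L[ℝ] ℝ) :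
    dualToL2 hμ f = (memLp_dual hμ f).toLp f := rfl

/-- Bounded pointwise convergence of functionals implies convergence in `L²(μ)`. -/
lemma tendsto_dualToL2 (hμ : MemLp (fun x : X ↦ ‖x‖) 2 μ) {f : ℕ → X →L[ℝ] ℝ} {g : X →L[ℝ] ℝ}
    (hf : ∀ n, ‖f n‖ ≤ 1) (hg : ‖g‖ ≤ 1) (h : ∀ x, Tendsto (fun n ↦ f n x) atTop (𝓝 (g x))) :
    Tendsto (fun n ↦ dualToL2 hμ (f n)) atTop (𝓝 (dualToL2 hμ g)) := by
  simp only [dualToL2_apply]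
  rw [Lp.tendsto_Lp_iff_tendsto_eLpNorm'' (fun n ↦ (f n : X → ℝ))
    (fun n ↦ memLp_dual hμ (f n)) g (memLp_dual hμ g)]
  simp only [eLpNorm_eq_lintegral_rpow_enorm_toReal two_ne_zero ENNReal.ofNat_ne_top,
    ENNReal.toReal_ofNat, Pi.sub_apply]
  have hlim : Tendsto (fun n ↦ ∫⁻ x, ‖f n x - g x‖ₑ ^ (2 : ℝ) ∂μ) atTop (𝓝 (∫⁻ _, 0 ∂μ)) := by
    refine tendsto_lintegral_of_dominated_convergence (fun x ↦ ‖(2 : ℝ) * ‖x‖‖ₑ ^ (2 : ℝ))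
      (fun n ↦ by
        have := ((f n).continuous.sub g.continuous).enorm.measurable
        exact this.pow_const _) (fun n ↦ ae_of_all _ fun x ↦ ?_) ?_ (ae_of_all _ fun x ↦ ?_)
    · refine ENNReal.rpow_le_rpow (enorm_le_iff_norm_le.2 ?_) (by norm_num)
      have h1 := (f n).le_of_opNorm_le (hf n) x
      have h2 := g.le_of_opNorm_le hg x
      rw [norm_mul, norm_norm, Real.norm_ofNat]
      linarith [norm_sub_le (f n x) (g x)]
    · exact (lintegral_rpow_enorm_lt_top_of_eLpNorm_lt_top two_ne_zero ENNReal.ofNat_ne_top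
        (hμ.const_mul 2).eLpNorm_lt_top).ne
    · have h0 : Tendsto (fun n ↦ ‖f n x - g x‖ₑ) atTop (𝓝 0) := by
        simpa using ((h x).sub_const (g x)).enorm
      simpa using h0.ennrpow_const 2
  simpa using hlim.ennrpow_const (1 / 2)

set_option maxSynthPendingDepth 3 in
open TopologicalSpace in
/-- The unit ball of the dual of a reflexive space is sequentially compact in `L²(μ)`. -/
lemma isSeqCompact_image_closedBall
    (hrefl : Function.Surjective (NormedSpace.inclusionInDoubleDual ℝ X))
    (hμ : MemLp (fun x : X ↦ ‖x‖) 2 μ) :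
    IsSeqCompact (dualToL2 hμ '' Metric.closedBall 0 1) := by
  intro u hu
  choose f hf hfu using hu
  obtain ⟨P, hP, hPsep, -, hPf⟩ := exists_contraction_isSeparable_range hrefl
    Set.countable_empty.isSeparable (Set.countable_range f).isSeparable
  let Y := P.toLinearMap.range
  have : SeparableSpace Y := hPsep.separableSpace
  let r (n : ℕ) : WeakDual ℝ Y := StrongDual.toWeakDual ((f n).comp Y.subtypeL)
  have hr (n : ℕ) : r n ∈ WeakDual.toStrongDual ⁻¹' Metric.closedBall (0 : StrongDual ℝ Y) 1 := by
    rw [Set.mem_preimage, Metric.mem_closedBall, dist_zero_right]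
    refine ContinuousLinearMap.opNorm_le_bound _ zero_le_one fun y ↦ ?_
    exact (f n).le_of_opNorm_le (by simpa using hf n) y
  obtain ⟨g, hg, φ, hφ, hlim⟩ := WeakDual.isSeqCompact_closedBall ℝ Y 0 1 hr
  simp only [Set.mem_preimage, mem_closedBall_zero_iff] at hg
  let g' : X →L[ℝ] ℝ := (WeakDual.toStrongDual g).comp (P.codRestrict Y fun x ↦ ⟨x, rfl⟩)
  have hg' : ‖g'‖ ≤ 1 := ContinuousLinearMap.opNorm_le_bound _ zero_le_one fun x ↦ by
    refine ((WeakDual.toStrongDual g).le_of_opNorm_le hg _).trans ?_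
    rw [one_mul, one_mul]
    exact hP x
  refine ⟨dualToL2 hμ g', ⟨g', by simpa using hg', rfl⟩, φ, hφ, ?_⟩
  have : u ∘ φ = fun n ↦ dualToL2 hμ (f (φ n)) := funext fun n ↦ (hfu (φ n)).symm
  rw [this]
  refine tendsto_dualToL2 hμ (fun n ↦ by simpa using hf (φ n)) hg' fun x ↦ ?_
  have h1 := tendsto_iff_forall_eval_tendsto_topDualPairing.1 hlim ⟨P x, x, rfl⟩
  refine (tendsto_congr fun n ↦ ?_).1 h1
  exact hPf _ ⟨φ n, rfl⟩ x

open TopologicalSpace in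
lemma isSeparable_range_dualToL2
    (hrefl : Function.Surjective (NormedSpace.inclusionInDoubleDual ℝ X))
    (hμ : MemLp (fun x : X ↦ ‖x‖) 2 μ) : IsSeparable (Set.range (dualToL2 hμ)) := by
  refine (isSeqCompact_image_closedBall hrefl hμ).isCompact.isSeparable.span (R := ℝ) |>.mono ?_
  rintro _ ⟨f, rfl⟩
  have hf : f ∈ Submodule.span ℝ (Metric.closedBall (0 : X →L[ℝ] ℝ) 1) := by
    rcases eq_or_ne f 0 with rfl | h0
    · exact zero_mem _
    · rw [← smul_inv_smul₀ (norm_ne_zero_iff.2 h0) f]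
      refine Submodule.smul_mem _ _ (Submodule.subset_span ?_)
      rw [mem_closedBall_zero_iff, norm_smul, norm_inv, norm_norm,
        inv_mul_cancel₀ (norm_ne_zero_iff.2 h0)]
  exact Submodule.image_span_subset_span (dualToL2 hμ).toLinearMap _ ⟨f, hf, rfl⟩

open TopologicalSpace in
/-- In a reflexive space, a Borel measure with square integrable norm is weakly equivalent to its
image under a contraction with separable range. -/
lemma exists_contraction_forall_dual_ae_eq
    (hrefl : Function.Surjective (NormedSpace.inclusionInDoubleDual ℝ X))
    (hμ : MemLp (fun x : X ↦ ‖x‖) 2 μ) :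
    ∃ P : X →L[ℝ] X, (∀ x, ‖P x‖ ≤ ‖x‖) ∧ IsSeparable (Set.range P) ∧
      ∀ f : X →L[ℝ] ℝ, (fun x ↦ f (P x)) =ᵐ[μ] f := by
  let T := dualToL2 hμ
  obtain ⟨c, hc, hTc⟩ := isSeparable_range_dualToL2 hrefl hμ
  have hy (u : Lp ℝ 2 μ) : ∃ y : X, ∀ f : X →L[ℝ] ℝ, f y = inner ℝ u (T f) := by
    obtain ⟨y, hy⟩ := hrefl ((innerSL ℝ u).comp T)
    exact ⟨y, fun f ↦ by simpa using DFunLike.congr_fun hy f⟩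
  choose y hy using hy
  obtain ⟨P, hP, hPsep, hPA, -⟩ := exists_contraction_isSeparable_range hrefl
    (hc.image y).isSeparable (B := ∅) Set.countable_empty.isSeparable
  refine ⟨P, hP, hPsep, fun f ↦ ?_⟩
  let h : X →L[ℝ] ℝ := f.comp P - f
  have hperp : closure c ⊆ {u | inner ℝ u (T h) = 0} := by
    refine closure_minimal (fun u hu ↦ ?_)
      (isClosed_eq (continuous_id.inner continuous_const) continuous_const)
    rw [Set.mem_ofPred_eq, ← hy]
    simp [h, hPA (y u) ⟨u, hu, rfl⟩]
  have hTh : T h = 0 := inner_self_eq_zero.1 (hperp (hTc ⟨h, rfl⟩))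
  have h0 := (memLp_dual hμ h).coeFn_toLp
  rw [← dualToL2_apply hμ, show dualToL2 hμ h = 0 from hTh] at h0
  filter_upwards [h0, Lp.coeFn_zero ℝ 2 μ] with x hx hx0
  rw [hx0] at hx
  exact (sub_eq_zero.1 hx.symm : f (P x) = f x)

end Borel

lemma rpow_lintegral_nnnorm_sq_eq_eLpNorm {X : Type*} [NormedAddCommGroup X]
    [MeasurableSpace X] (μ : Measure X) :
    (∫⁻ x, (‖x‖₊ : ℝ≥0∞) ^ 2 ∂μ) ^ (1 / 2 : ℝ) = eLpNorm (fun x : X ↦ ‖x‖) 2 μ := by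
  rw [eLpNorm_eq_lintegral_rpow_enorm_toReal two_ne_zero ENNReal.ofNat_ne_top]
  simp [enorm_eq_nnnorm]

lemma map_add_prod_eq_gaussianReal {α β : Type*} {mα : MeasurableSpace α} {mβ : MeasurableSpace β}
    {μ : Measure α} {ν : Measure β} [IsProbabilityMeasure μ] [IsProbabilityMeasure ν]
    {f : α → ℝ} {g : β → ℝ} (hf : Measurable f) (hg : Measurable g) {v w : ℝ≥0}
    (hfv : μ.map f = gaussianReal 0 v) (hgw : ν.map g = gaussianReal 0 w) :
    (μ.prod ν).map (fun p ↦ f p.1 + g p.2) = gaussianReal 0 (v + w) := by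
  have h1 : (μ.prod ν).map (fun p ↦ f p.1) = gaussianReal 0 v := by
    change (μ.prod ν).map (f ∘ Prod.fst) = _
    rw [← hfv, ← Measure.map_map hf measurable_fst, Measure.map_fst_prod, measure_univ, one_smul]
  have h2 : (μ.prod ν).map (fun p ↦ g p.2) = gaussianReal 0 w := by
    change (μ.prod ν).map (g ∘ Prod.snd) = _
    rw [← hgw, ← Measure.map_map hg measurable_snd, Measure.map_snd_prod, measure_univ, one_smul]
  rw [← add_zero (0 : ℝ)]
  exact gaussianReal_add_gaussianReal_of_indepFun (indepFun_prod hf hg) h1 h2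

lemma integral_add_mul_add_prod {α β : Type*} {mα : MeasurableSpace α} {mβ : MeasurableSpace β}
    {μ : Measure α} {ν : Measure β} [IsProbabilityMeasure μ] [IsProbabilityMeasure ν]
    {f f' : α → ℝ} {g g' : β → ℝ} (hf : MemLp f 2 μ) (hf' : MemLp f' 2 μ)
    (hg : MemLp g 2 ν) (hg' : MemLp g' 2 ν) (hf0 : ∫ x, f x ∂μ = 0) (hf0' : ∫ x, f' x ∂μ = 0) :
    ∫ p, (f p.1 + g p.2) * (f' p.1 + g' p.2) ∂μ.prod ν =
      ∫ x, f x * f' x ∂μ + ∫ y, g y * g' y ∂ν := by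
  have h1 : Integrable (fun p : α × β ↦ f p.1 * f' p.1) (μ.prod ν) :=
    (hf.integrable_mul hf').comp_fst ν
  have h2 : Integrable (fun p : α × β ↦ g p.2 * g' p.2) (μ.prod ν) :=
    (hg.integrable_mul hg').comp_snd μ
  have h3 : Integrable (fun p : α × β ↦ f p.1 * g' p.2) (μ.prod ν) :=
    (hf.integrable one_le_two).mul_prod (hg'.integrable one_le_two)
  have h4 : Integrable (fun p : α × β ↦ f' p.1 * g p.2) (μ.prod ν) :=
    (hf'.integrable one_le_two).mul_prod (hg.integrable one_le_two)
  calc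
    _ = ∫ p, ((f p.1 * f' p.1 + g p.2 * g' p.2) + (f p.1 * g' p.2 + f' p.1 * g p.2))
          ∂μ.prod ν := by congr with p; ring
    _ = _ := by
      rw [integral_add (by exact h1.add h2) (by exact h3.add h4), integral_add h1 h2,
        integral_add h3 h4, integral_prod_mul, integral_prod_mul, hf0, hf0',
        integral_fun_fst (fun x ↦ f x * f' x), integral_fun_snd (fun y ↦ g y * g' y)]
      simp

lemma integral_eq_zero_of_map_eq_gaussianReal {α : Type*} {mα : MeasurableSpace α} {μ : Measure α}
    {f : α → ℝ} (hf : Measurable f) {v : ℝ≥0} (h : μ.map f = gaussianReal 0 v) :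
    ∫ x, f x ∂μ = 0 := by
  rw [← integral_map hf.aemeasurable (f := fun y ↦ y) aestronglyMeasurable_id, h,
    integral_id_gaussianReal]

/-- Centered Gaussian measures on a reflexive space admit a centered Gaussian measure with the sum
covariance whose `L²`-norm is at most the sum of the `L²`-norms. -/
lemma exists_gaussian_add {X : Type*} [NormedAddCommGroup X] [NormedSpace ℝ X]
    [MeasurableSpace X] [BorelSpace X]
    (hrefl : Function.Surjective (NormedSpace.inclusionInDoubleDual ℝ X))
    {μ ν : Measure X} [IsProbabilityMeasure μ] [IsProbabilityMeasure ν]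
    (hμ : MemLp (fun x : X ↦ ‖x‖) 2 μ) (hν : MemLp (fun x : X ↦ ‖x‖) 2 ν)
    (hμg : ∀ f : X →L[ℝ] ℝ, ∃ v : ℝ≥0, μ.map f = gaussianReal 0 v)
    (hνg : ∀ f : X →L[ℝ] ℝ, ∃ v : ℝ≥0, ν.map f = gaussianReal 0 v) :
    ∃ ρ : Measure X, IsProbabilityMeasure ρ ∧
      (∀ f : X →L[ℝ] ℝ, ∃ v : ℝ≥0, ρ.map f = gaussianReal 0 v) ∧
      (∀ f g : X →L[ℝ] ℝ,
        ∫ x, f x * g x ∂ρ = ∫ x, f x * g x ∂μ + ∫ x, f x * g x ∂ν) ∧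
      eLpNorm (fun x : X ↦ ‖x‖) 2 ρ ≤
        eLpNorm (fun x : X ↦ ‖x‖) 2 μ + eLpNorm (fun x : X ↦ ‖x‖) 2 ν := by
  obtain ⟨P, hP, hPsep, hPμ⟩ := exists_contraction_forall_dual_ae_eq hrefl hμ
  obtain ⟨Q, hQ, hQsep, hQν⟩ := exists_contraction_forall_dual_ae_eq hrefl hν
  have hPm : StronglyMeasurable P :=
    stronglyMeasurable_iff_measurable_separable.2 ⟨P.continuous.measurable, hPsep⟩
  have hQm : StronglyMeasurable Q :=
    stronglyMeasurable_iff_measurable_separable.2 ⟨Q.continuous.measurable, hQsep⟩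
  have hP1 : StronglyMeasurable fun p : X × X ↦ P p.1 := hPm.comp_measurable measurable_fst
  have hQ2 : StronglyMeasurable fun p : X × X ↦ Q p.2 := hQm.comp_measurable measurable_snd
  have hS : Measurable fun p : X × X ↦ P p.1 + Q p.2 := (hP1.add hQ2).measurable
  have hfm (f : X →L[ℝ] ℝ) : Measurable f := f.continuous.measurable
  refine ⟨(μ.prod ν).map fun p ↦ P p.1 + Q p.2, Measure.isProbabilityMeasure_map hS.aemeasurable,
    fun f ↦ ?_, fun f g ↦ ?_, ?_⟩
  · obtain ⟨v, hv⟩ := hμg (f.comp P)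
    obtain ⟨w, hw⟩ := hνg (f.comp Q)
    refine ⟨v + w, ?_⟩
    rw [Measure.map_map (hfm f) hS, ← map_add_prod_eq_gaussianReal (hfm _) (hfm _) hv hw]
    congr 1
    ext p
    simp
  · have hfg : Measurable fun x ↦ f x * g x := (hfm f).mul (hfm g)
    rw [integral_map hS.aemeasurable hfg.aestronglyMeasurable]
    have h0 (f : X →L[ℝ] ℝ) : ∫ x, f x ∂μ = 0 :=
      integral_eq_zero_of_map_eq_gaussianReal (hfm f) (hμg f).choose_spec
    have h := integral_add_mul_add_prod (memLp_dual hμ (f.comp P)) (memLp_dual hμ (g.comp P))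
      (memLp_dual hν (f.comp Q)) (memLp_dual hν (g.comp Q)) (h0 _) (h0 _)
    have h1 : ∫ x, f (P x) * g (P x) ∂μ = ∫ x, f x * g x ∂μ :=
      integral_congr_ae ((hPμ f).mul (hPμ g))
    have h2 : ∫ x, f (Q x) * g (Q x) ∂ν = ∫ x, f x * g x ∂ν :=
      integral_congr_ae ((hQν f).mul (hQν g))
    simp only [map_add]
    rw [← h1, ← h2]
    exact h
  · have hfst : eLpNorm (fun p : X × X ↦ P p.1) 2 (μ.prod ν) = eLpNorm P 2 μ :=
      eLpNorm_comp_measurePreserving hPm.aestronglyMeasurable measurePreserving_fst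
    have hsnd : eLpNorm (fun p : X × X ↦ Q p.2) 2 (μ.prod ν) = eLpNorm Q 2 ν :=
      eLpNorm_comp_measurePreserving hQm.aestronglyMeasurable measurePreserving_snd
    calc
      _ = eLpNorm (fun p : X × X ↦ P p.1 + Q p.2) 2 (μ.prod ν) := by
        rw [eLpNorm_map_measure continuous_norm.measurable.aestronglyMeasurable hS.aemeasurable]
        exact eLpNorm_norm _
      _ ≤ eLpNorm P 2 μ + eLpNorm Q 2 ν := by
        rw [← hfst, ← hsnd]
        exact eLpNorm_add_le hP1.aestronglyMeasurable hQ2.aestronglyMeasurable one_le_two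
      _ ≤ _ := add_le_add (eLpNorm_mono fun x ↦ by simpa using hP x)
        (eLpNorm_mono fun x ↦ by simpa using hQ x)

/-- **Triangle inequality for the Gaussian characteristic** (Lemma 3.3).
Let `X` be a reflexive Banach space and `V, W` symmetric continuous nonnegative bilinear
forms on `X* × X*`. Then `γ(V + W) ≤ γ(V) + γ(W)`. -/
theorem gaussianChar_add_le
    (X : Type*) [NormedAddCommGroup X] [NormedSpace ℝ X]
    (hrefl : Function.Surjective (NormedSpace.inclusionInDoubleDual ℝ X))
    (V W : (X →L[ℝ] ℝ) → (X →L[ℝ] ℝ) → ℝ)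
    (hV : IsContNonnegSymmBilinear V) (hW : IsContNonnegSymmBilinear W) :
    gaussianChar X (fun f g => V f g + W f g) ≤ gaussianChar X V + gaussianChar X W := by
  let : MeasurableSpace X := borel X
  have : BorelSpace X := ⟨rfl⟩
  suffices h : ∀ μ ν : Measure X, IsProbabilityMeasure μ → IsProbabilityMeasure ν →
      (∀ f : X →L[ℝ] ℝ, ∃ v : ℝ≥0, μ.map f = gaussianReal 0 v) →
      (∀ f : X →L[ℝ] ℝ, ∃ v : ℝ≥0, ν.map f = gaussianReal 0 v) →
      (∀ f g : X →L[ℝ] ℝ, ∫ x, f x * g x ∂μ = V f g) →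
      (∀ f g : X →L[ℝ] ℝ, ∫ x, f x * g x ∂ν = W f g) →
      gaussianChar X (fun f g => V f g + W f g) ≤
        eLpNorm (fun x : X ↦ ‖x‖) 2 μ + eLpNorm (fun x : X ↦ ‖x‖) 2 ν by
    unfold gaussianChar at h ⊢
    rw [ENNReal.sInf_add]
    refine le_iInf₂ fun c ⟨μ, hμ, hμg, hμV, hc⟩ ↦ ?_
    rw [add_comm c, ENNReal.sInf_add]
    refine le_iInf₂ fun d ⟨ν, hν, hνg, hνW, hd⟩ ↦ ?_
    rw [hc, hd, rpow_lintegral_nnnorm_sq_eq_eLpNorm, rpow_lintegral_nnnorm_sq_eq_eLpNorm, add_comm]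
    exact h μ ν hμ hν hμg hνg hμV hνW
  intro μ ν hμ hν hμg hνg hμV hνW
  by_cases htop : eLpNorm (fun x : X ↦ ‖x‖) 2 μ + eLpNorm (fun x : X ↦ ‖x‖) 2 ν = ∞
  · rw [htop]
    exact le_top
  have hnm : StronglyMeasurable fun x : X ↦ ‖x‖ := continuous_norm.measurable.stronglyMeasurable
  obtain ⟨hμ2, hν2⟩ := ENNReal.add_lt_top.1 (lt_top_iff_ne_top.2 htop)
  obtain ⟨ρ, hρ, hρg, hρV, hle⟩ := exists_gaussian_add hrefl
    ⟨hnm.aestronglyMeasurable, hμ2⟩ ⟨hnm.aestronglyMeasurable, hν2⟩ hμg hνg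
  refine le_trans (sInf_le ⟨ρ, hρ, hρg, fun f g ↦ ?_, rfl⟩)
    ((rpow_lintegral_nnnorm_sq_eq_eLpNorm ρ).trans_le hle)
  rw [hρV, hμV, hνW]

end
end
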